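/- arXiv:2302.03077 — 3 statements merged into one kernel-verified Lean document; each statement's English description precedes it below -/
import Mathlib

section
/- Every skew morphism of a nontrivial finite group A has nontrivial kernel: there exists a non-identity element x ∈ A with π(x) ≡ 1 (mod |φ|). -/
def IsSkewMorphism {A : Type*} [Group A] (φ : Equiv.Perm A) (π : A → ℤ) : Prop :=
  φ 1 = 1 ∧ ∀ a b : A, φ (a * b) = φ a * (φ ^ π a) b

def IsSmooth {A : Type*} [Group A] (φ : Equiv.Perm A) (π : A → ℤ) : Prop :=
  ∀ a : A, π (φ a) ≡ π a [ZMOD (orderOf φ)]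

theorem sk_grow {G : Type*} [Group G] [Finite G] (p : ℕ) [Fact p.Prime] (K : Set G)
    (hK : ∀ g k, k ∈ K → g * k * g⁻¹ ∈ K) (P F : Subgroup G) (hP : IsPGroup p P) (hF : F ≤ P)
    (hne : ¬ (K ∩ (P : Set G) ⊆ F)) :
    ∃ y ∈ K, y ∈ P ∧ y ∉ F ∧ ∀ d ∈ K ∩ (F : Set G), y * d * y⁻¹ ∈ K ∩ (F : Set G) := by
  classical
  let S : Set (Subgroup G) := {E | F ≤ E ∧ E ≤ P ∧ K ∩ (E : Set G) ⊆ F}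
  have hS : S.Finite := Set.toFinite S
  obtain ⟨E, hE⟩ := hS.exists_maximal ⟨F, le_refl _, hF, fun x hx => hx.2⟩
  obtain ⟨⟨hFE, hEP, hKE⟩, hmax⟩ := hE
  have hnP : ¬ P ≤ E := fun hle => hne (fun x hx => hKE ⟨hx.1, hle hx.2⟩)
  have hnil := IsPGroup.isNilpotent hP
  have hnc : NormalizerCondition P := Group.normalizerCondition_of_isNilpotent
  have hlt : E.subgroupOf P < ⊤ := by
    rw [lt_top_iff_ne_top, Ne, Subgroup.subgroupOf_eq_top]; exact hnP
  have h2 := hnc _ hlt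
  rw [← Subgroup.subgroupOf_normalizer_eq hEP] at h2
  obtain ⟨w, hw1, hw2⟩ := SetLike.exists_of_lt h2
  rw [Subgroup.mem_subgroupOf] at hw1 hw2
  by_contra hcon
  push Not at hcon
  have hin : P ⊓ Subgroup.normalizer (E : Set G) ∈ S := by
    refine ⟨hFE.trans (le_inf hEP Subgroup.le_normalizer), inf_le_left, ?_⟩
    rintro y ⟨hyK, hyP, hyN⟩
    by_contra hyF
    obtain ⟨d, hd, hd2⟩ := hcon y hyK hyP hyF
    apply hd2
    have h3 : y * d * y⁻¹ ∈ E := (Subgroup.mem_normalizer_iff.1 hyN d).1 (hFE hd.2)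
    exact ⟨hK _ _ hd.1, hKE ⟨hK _ _ hd.1, h3⟩⟩
  exact hw2 (hmax hin (le_inf hEP Subgroup.le_normalizer) ⟨w.2, hw1⟩)

theorem sk_baer {G : Type*} [Group G] [Finite G] (p : ℕ) [Fact p.Prime] (x : G)
    (h : ∀ g : G, ∃ Q : Subgroup G, IsPGroup p Q ∧ x ∈ Q ∧ g * x * g⁻¹ ∈ Q) :
    IsPGroup p (Subgroup.normalClosure {x}) := by
  classical
  let K : Set G := {y | ∃ g, y = g * x * g⁻¹}
  have hK : ∀ g k, k ∈ K → g * k * g⁻¹ ∈ K := by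
    rintro g _ ⟨a, rfl⟩; exact ⟨g * a, by group⟩
  have hKK : ∀ y ∈ K, ∀ z ∈ K, ∃ Q : Subgroup G, IsPGroup p Q ∧ y ∈ Q ∧ z ∈ Q := by
    rintro _ ⟨a, rfl⟩ _ ⟨b, rfl⟩
    obtain ⟨Q, hQ, h1, h2⟩ := h (a⁻¹ * b)
    refine ⟨Q.map (MulAut.conj a).toMonoidHom, hQ.map _, ⟨x, h1, rfl⟩, ⟨_, h2, ?_⟩⟩
    simp [mul_assoc]
  have hcard : ∀ P Q : Sylow p G, (K ∩ (P : Set G)).ncard = (K ∩ (Q : Set G)).ncard := by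
    have key : ∀ P Q : Sylow p G, (K ∩ (P : Set G)).ncard ≤ (K ∩ (Q : Set G)).ncard := by
      intro P Q
      obtain ⟨g, rfl⟩ := MulAction.exists_smul_eq G P Q
      refine Set.ncard_le_ncard_of_injOn (fun k => g * k * g⁻¹) ?_ ?_ (Set.toFinite _)
      · rintro k ⟨hk, hkP⟩
        refine ⟨hK _ _ hk, ?_⟩
        change g * k * g⁻¹ ∈ ((g • P : Sylow p G) : Subgroup G)
        rw [Sylow.coe_subgroup_smul]
        exact Subgroup.smul_mem_pointwise_smul k (MulAut.conj g) _ hkP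
      · intro a _ b _ hab
        simpa using hab
    exact fun P Q => le_antisymm (key P Q) (key Q P)
  have claim : ∀ P Q : Sylow p G, K ∩ (P : Set G) = K ∩ (Q : Set G) := by
    by_contra hcon
    let S : Set (Sylow p G × Sylow p G) := {r | K ∩ (r.1 : Set G) ≠ K ∩ (r.2 : Set G)}
    have hSne : S.Nonempty := by
      push Not at hcon
      obtain ⟨P, Q, hPQ⟩ := hcon
      exact ⟨(P, Q), hPQ⟩
    obtain ⟨⟨P, Q⟩, hPQ, hmax⟩ := Set.exists_max_image S
      (fun r => (K ∩ (r.1 : Set G) ∩ (r.2 : Set G)).ncard) (Set.toFinite S) hSne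
    have hPQ' : K ∩ (P : Set G) ≠ K ∩ (Q : Set G) := hPQ
    let F : Subgroup G := (P : Subgroup G) ⊓ (Q : Subgroup G)
    have n1 : ¬ (K ∩ (P : Set G) ⊆ (F : Set G)) := by
      intro hs
      apply hPQ'
      have hsub : K ∩ (P : Set G) ⊆ K ∩ (Q : Set G) := fun y hy => ⟨hy.1, (hs hy).2⟩
      exact Set.eq_of_subset_of_ncard_le hsub (hcard Q P).le (Set.toFinite _)
    have n2 : ¬ (K ∩ (Q : Set G) ⊆ (F : Set G)) := by
      intro hs
      apply hPQ'
      have hsub : K ∩ (Q : Set G) ⊆ K ∩ (P : Set G) := fun y hy => ⟨hy.1, (hs hy).1⟩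
      exact (Set.eq_of_subset_of_ncard_le hsub (hcard P Q).le (Set.toFinite _)).symm
    obtain ⟨y, hyK, hyP, hyF, hyn⟩ := sk_grow p K hK P F P.isPGroup' inf_le_left n1
    obtain ⟨z, hzK, hzQ, hzF, hzn⟩ := sk_grow p K hK Q F Q.isPGroup' inf_le_right n2
    obtain ⟨T, hT, hyT, hzT⟩ := hKK y hyK z hzK
    let D := Subgroup.closure (K ∩ (F : Set G))
    have hDF : D ≤ F := (Subgroup.closure_le _).2 (fun a ha => ha.2)
    have hDp : IsPGroup p D := P.isPGroup'.to_le (hDF.trans inf_le_left)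
    have norm_of : ∀ y : G, (∀ d ∈ K ∩ (F : Set G), y * d * y⁻¹ ∈ K ∩ (F : Set G)) →
        y ∈ Subgroup.normalizer (D : Set G) := by
      intro y hy
      have h1 : D.map (MulAut.conj y).toMonoidHom ≤ D := by
        rw [Subgroup.map_le_iff_le_comap]
        refine (Subgroup.closure_le _).2 (fun a ha => Subgroup.subset_closure ?_)
        simpa using hy a ha
      have h2 : D.map (MulAut.conj y).toMonoidHom = D := by
        apply Subgroup.eq_of_le_of_card_ge h1
        rw [Subgroup.card_map_of_injective (MulAut.conj y).injective]
      rw [Subgroup.mem_normalizer_iff]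
      intro a
      constructor
      · intro ha
        exact h1 ⟨a, ha, by simp⟩
      · intro ha
        rw [← h2] at ha
        obtain ⟨b, hb, hb2⟩ := ha
        have : b = a := by simpa using hb2
        exact this ▸ hb
    have hW : IsPGroup p (T ⊓ Subgroup.normalizer (D : Set G) ⊔ D : Subgroup G) :=
      IsPGroup.to_sup_of_normal_right' (hT.to_le inf_le_left) hDp inf_le_right
    obtain ⟨R, hR⟩ := hW.exists_le_sylow
    have hyR : y ∈ R := hR (Subgroup.mem_sup_left ⟨hyT, norm_of y hyn⟩)
    have hzR : z ∈ R := hR (Subgroup.mem_sup_left ⟨hzT, norm_of z hzn⟩)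
    have hDR : ∀ d ∈ K ∩ (F : Set G), d ∈ R := fun d hd =>
      hR (Subgroup.mem_sup_right (Subgroup.subset_closure hd))
    have e1 : K ∩ (P : Set G) = K ∩ (R : Set G) := by
      by_contra hne
      have := hmax (P, R) hne
      refine absurd this (not_le.2 (Set.ncard_lt_ncard ?_ (Set.toFinite _)))
      rw [Set.ssubset_iff_of_subset]
      · exact ⟨y, ⟨⟨hyK, hyP⟩, hyR⟩, fun hh => hyF ⟨hyP, hh.2⟩⟩
      · rintro d ⟨⟨h1, h2⟩, h3⟩
        exact ⟨⟨h1, h2⟩, hDR d ⟨h1, h2, h3⟩⟩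
    have e2 : K ∩ (R : Set G) = K ∩ (Q : Set G) := by
      by_contra hne
      have := hmax (R, Q) hne
      refine absurd this (not_le.2 (Set.ncard_lt_ncard ?_ (Set.toFinite _)))
      rw [Set.ssubset_iff_of_subset]
      · exact ⟨z, ⟨⟨hzK, hzR⟩, hzQ⟩, fun hh => hzF ⟨hh.1.2, hzQ⟩⟩
      · rintro d ⟨⟨h1, h2⟩, h3⟩
        exact ⟨⟨h1, hDR d ⟨h1, h2, h3⟩⟩, h3⟩
    exact hPQ' (e1.trans e2)
  obtain ⟨Q0, hQ0, hxQ0, -⟩ := h 1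
  obtain ⟨P, hP⟩ := hQ0.exists_le_sylow
  refine P.isPGroup'.to_le ?_
  refine (Subgroup.closure_le _).2 ?_
  intro y hy
  rw [Group.mem_conjugatesOfSet_iff] at hy
  obtain ⟨a, ha, hay⟩ := hy
  rw [Set.mem_singleton_iff] at ha
  subst ha
  obtain ⟨g, rfl⟩ := isConj_iff.1 hay
  obtain ⟨Q, hQ, -, h2⟩ := h g
  obtain ⟨P', hP'⟩ := hQ.exists_le_sylow
  have : g * a * g⁻¹ ∈ K ∩ (P' : Set G) := ⟨⟨g, rfl⟩, hP' h2⟩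
  rw [claim P' P] at this
  exact this.2

theorem sk_baerH {G : Type*} [Group G] [Finite G] (p : ℕ) [Fact p.Prime] (H : Subgroup G) (x : G)
    (hx : x ∈ H)
    (h : ∀ g ∈ H, ∃ Q : Subgroup G, IsPGroup p Q ∧ x ∈ Q ∧ g * x * g⁻¹ ∈ Q) :
    ∃ N : Subgroup G, N ≤ H ∧ IsPGroup p N ∧ (∀ g ∈ H, ∀ n ∈ N, g * n * g⁻¹ ∈ N) ∧ x ∈ N := by
  have hb := sk_baer p (⟨x, hx⟩ : H) (by
    rintro ⟨g, hg⟩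
    obtain ⟨Q, hQ, h1, h2⟩ := h g hg
    exact ⟨Q.subgroupOf H, hQ.comap_of_injective _ H.subtype_injective, h1, h2⟩)
  refine ⟨(Subgroup.normalClosure {(⟨x, hx⟩ : H)}).map H.subtype, ?_, hb.map _, ?_, ?_⟩
  · rintro _ ⟨y, -, rfl⟩; exact y.2
  · rintro g hg _ ⟨y, hy, rfl⟩
    exact ⟨⟨g, hg⟩ * y * ⟨g, hg⟩⁻¹, Subgroup.normalClosure_normal.conj_mem _ hy _, rfl⟩
  · exact ⟨⟨x, hx⟩, Subgroup.subset_normalClosure rfl, rfl⟩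

/-- The conjugate `g B g⁻¹`. -/
def sk_cj {G : Type*} [Group G] (g : G) (B : Subgroup G) : Subgroup G :=
  B.comap (MulAut.conj g⁻¹).toMonoidHom

theorem sk_mem_cj {G : Type*} [Group G] {g y : G} {B : Subgroup G} :
    y ∈ sk_cj g B ↔ g⁻¹ * y * g ∈ B := by
  simp [sk_cj, Subgroup.mem_comap]

theorem sk_card_cj {G : Type*} [Group G] (g : G) (B : Subgroup G) :
    Nat.card (sk_cj g B) = Nat.card B := by
  refine Nat.card_congr ⟨fun y => ⟨g⁻¹ * y * g, sk_mem_cj.1 y.2⟩,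
    fun b => ⟨g * b * g⁻¹, sk_mem_cj.2 (by simpa [mul_assoc] using b.2)⟩, ?_, ?_⟩
  · intro y; ext; simp [mul_assoc]
  · intro y; ext; simp [mul_assoc]

theorem sk_le_normalizer {G : Type*} [Group G] {J N : Subgroup G}
    (h : ∀ g ∈ J, ∀ n ∈ N, g * n * g⁻¹ ∈ N) : J ≤ Subgroup.normalizer (N : Set G) := by
  intro g hg
  rw [Subgroup.mem_normalizer_iff]
  intro a
  refine ⟨h g hg a, fun ha => ?_⟩
  have := h g⁻¹ (J.inv_mem hg) _ ha
  simpa [mul_assoc] using this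

theorem sk_zenkov {G : Type*} [Group G] [Finite G] (p : ℕ) [Fact p.Prime] :
    ∀ (n : ℕ) (H A B : Subgroup G), Nat.card H = n → A ≤ H → B ≤ H →
      (∀ a ∈ A, ∀ b ∈ A, a * b = b * a) → (∀ a ∈ B, ∀ b ∈ B, a * b = b * a) →
      (∀ h ∈ H, Nat.card (A ⊓ B : Subgroup G) ≤ Nat.card (A ⊓ sk_cj h B : Subgroup G)) →
      ∀ x ∈ A ⊓ B, IsPGroup p (Subgroup.zpowers x) →
      ∃ N : Subgroup G, N ≤ H ∧ IsPGroup p N ∧ (∀ g ∈ H, ∀ n ∈ N, g * n * g⁻¹ ∈ N) ∧ x ∈ N := by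
  intro n
  induction n using Nat.strong_induction_on with
  | _ n ih =>
  intro H A B hn hA hB hAc hBc hmin x hx hxp
  refine sk_baerH p H x (hA hx.1) ?_
  intro g hg
  have hcjH : sk_cj g B ≤ H := by
    intro y hy
    rw [sk_mem_cj] at hy
    have := H.mul_mem (H.mul_mem hg (hB hy)) (H.inv_mem hg)
    simpa [mul_assoc] using this
  have hJH : A ⊔ sk_cj g B ≤ H := sup_le hA hcjH
  have hcjc : ∀ a ∈ sk_cj g B, ∀ b ∈ sk_cj g B, a * b = b * a := by
    intro a ha b hb
    rw [sk_mem_cj] at ha hb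
    have := hBc _ ha _ hb
    have h2 : g⁻¹ * (a * b) * g = g⁻¹ * (b * a) * g := by
      simpa [mul_assoc] using this
    simpa using h2
  by_cases hJ : A ⊔ sk_cj g B = H
  · have hcen : ∀ y ∈ A ⊓ sk_cj g B, g⁻¹ * y * g = y := by
      intro y hy
      have h1 : A ⊔ sk_cj g B ≤ Subgroup.centralizer {y} := by
        refine sup_le ?_ ?_
        · intro a ha
          rw [Subgroup.mem_centralizer_singleton_iff]
          exact hAc _ ha _ hy.1
        · intro a ha
          rw [Subgroup.mem_centralizer_singleton_iff]
          exact hcjc _ ha _ hy.2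
      rw [hJ] at h1
      have := Subgroup.mem_centralizer_singleton_iff.1 (h1 hg)
      rw [mul_assoc, ← this]; group
    have hle : A ⊓ sk_cj g B ≤ A ⊓ B := by
      intro y hy
      refine ⟨hy.1, ?_⟩
      have h2 := sk_mem_cj.1 hy.2
      rwa [hcen y hy] at h2
    have heq := Subgroup.eq_of_le_of_card_ge hle (hmin g hg)
    have hx2 := hcen x (heq ▸ hx)
    have hx3 : g * x * g⁻¹ = x := by
      conv_lhs => rw [← hx2]
      group
    refine ⟨Subgroup.zpowers x, hxp, Subgroup.mem_zpowers x, ?_⟩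
    rw [hx3]; exact Subgroup.mem_zpowers x
  · set J := A ⊔ sk_cj g B with hJdef
    have hAJ : A ≤ J := le_sup_left
    have hBJ : sk_cj g B ≤ J := le_sup_right
    have hlt : Nat.card J < n := by
      rw [← hn]
      by_contra hge
      exact hJ (Subgroup.eq_of_le_of_card_ge hJH (not_lt.1 hge))
    obtain ⟨N1, hN1J, hN1p, hN1n, hxN1⟩ := ih _ hlt J A (B ⊓ J) rfl hAJ inf_le_right hAc
      (fun a ha b hb => hBc a ha.1 b hb.1) (by
        intro j hj
        have e1 : A ⊓ (B ⊓ J) = A ⊓ B := by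
          ext y; constructor
          · exact fun hy => ⟨hy.1, hy.2.1⟩
          · exact fun hy => ⟨hy.1, hy.2, hAJ hy.1⟩
        have e2 : A ⊓ sk_cj j (B ⊓ J) = A ⊓ sk_cj j B := by
          ext y; constructor
          · exact fun hy => ⟨hy.1, sk_mem_cj.2 (sk_mem_cj.1 hy.2).1⟩
          · exact fun hy => ⟨hy.1, sk_mem_cj.2 ⟨sk_mem_cj.1 hy.2,
              J.mul_mem (J.mul_mem (J.inv_mem hj) (hAJ hy.1)) hj⟩⟩
        rw [e1, e2]
        exact hmin j (hJH hj)) x ⟨hx.1, hx.2, hAJ hx.1⟩ hxp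
    have hxc : g * x * g⁻¹ ∈ sk_cj g B := by
      rw [sk_mem_cj]; simpa [mul_assoc] using hx.2
    have hxa : g * x * g⁻¹ ∈ sk_cj g A := by
      rw [sk_mem_cj]; simpa [mul_assoc] using hx.1
    obtain ⟨N2, hN2J, hN2p, hN2n, hxN2⟩ := ih _ hlt J (sk_cj g B) (sk_cj g A ⊓ J) rfl hBJ
      inf_le_right hcjc
      (by
        rintro a ⟨ha, -⟩ b ⟨hb, -⟩
        have ha := sk_mem_cj.1 ha
        have hb := sk_mem_cj.1 hb
        have := hAc _ ha _ hb
        have h2 : g⁻¹ * (a * b) * g = g⁻¹ * (b * a) * g := by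
          simpa [mul_assoc] using this
        simpa using h2)
      (by
        intro j hj
        have e1 : sk_cj g B ⊓ (sk_cj g A ⊓ J) = sk_cj g (A ⊓ B) := by
          ext y; constructor
          · exact fun hy => sk_mem_cj.2 ⟨sk_mem_cj.1 hy.2.1, sk_mem_cj.1 hy.1⟩
          · intro hy
            have hy := sk_mem_cj.1 hy
            have h1 : y ∈ sk_cj g B := sk_mem_cj.2 hy.2
            exact ⟨h1, sk_mem_cj.2 hy.1, hBJ h1⟩
        have e2 : sk_cj g B ⊓ sk_cj j (sk_cj g A ⊓ J)
            = sk_cj (j * g) (A ⊓ sk_cj ((j * g)⁻¹ * g) B) := by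
          ext y
          have r1 : ((j * g)⁻¹ * g)⁻¹ * ((j * g)⁻¹ * y * (j * g)) * ((j * g)⁻¹ * g)
            = g⁻¹ * y * g := by group
          have r2 : (j * g)⁻¹ * y * (j * g) = g⁻¹ * (j⁻¹ * y * j) * g := by group
          rw [sk_mem_cj, Subgroup.mem_inf, Subgroup.mem_inf, sk_mem_cj, sk_mem_cj, sk_mem_cj, r1,
            r2, Subgroup.mem_inf, sk_mem_cj]
          constructor
          · rintro ⟨h1, h2, -⟩; exact ⟨h2, h1⟩
          · rintro ⟨h1, h2⟩
            exact ⟨h2, h1, J.mul_mem (J.mul_mem (J.inv_mem hj) (hBJ (sk_mem_cj.2 h2))) hj⟩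
        rw [e1, e2, sk_card_cj, sk_card_cj]
        exact hmin _ (H.mul_mem (H.inv_mem (H.mul_mem (hJH hj) hg)) hg))
      (g * x * g⁻¹) ⟨hxc, hxa, hBJ hxc⟩ (by
        have := hxp.map (MulAut.conj g).toMonoidHom
        rw [MonoidHom.map_zpowers] at this
        exact this)
    refine ⟨N1 ⊔ N2, IsPGroup.to_sup_of_normal_right' hN1p hN2p
      (hN1J.trans (sk_le_normalizer hN2n)), Subgroup.mem_sup_left hxN1,
      Subgroup.mem_sup_right hxN2⟩

theorem sk_meet {G : Type*} [Group G] [Finite G] (C : Subgroup G) (hC : C ≠ ⊤)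
    (hle : C.index ≤ Nat.card C) (hnb : C ≠ ⊥) (g : G) : C ⊓ sk_cj g C ≠ ⊥ := by
  intro hbot
  have inj : Function.Injective (fun r : C × C => (r.1 : G) * g * (r.2 : G)) := by
    rintro ⟨b, a⟩ ⟨b', a'⟩ h
    have h : (b : G) * g * a = b' * g * a' := h
    have h1 : ((b'⁻¹ * b : C) : G) = g * ((a' * a⁻¹ : C) : G) * g⁻¹ := by
      have : (b : G) = b' * g * a' * (a : G)⁻¹ * g⁻¹ := by rw [← h]; group
      push_cast
      rw [this]; simp [mul_assoc]
    have h2 : ((b'⁻¹ * b : C) : G) ∈ C ⊓ sk_cj g C := by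
      refine ⟨(b'⁻¹ * b : C).2, ?_⟩
      rw [h1]
      refine sk_mem_cj.2 ?_
      simpa [mul_assoc] using (C.mul_mem a'.2 (C.inv_mem a.2))
    rw [hbot, Subgroup.mem_bot] at h2
    have h3 : b = b' := by
      have : b'⁻¹ * b = 1 := Subtype.ext h2
      exact (inv_mul_eq_one.1 this).symm
    subst h3
    have h4 : (a : G) = a' := by simpa using h
    rw [Subtype.ext h4]
  have hcard : Nat.card (C × C) = Nat.card G := by
    apply le_antisymm
    · exact Nat.card_le_card_of_injective _ inj
    · rw [Nat.card_prod, ← C.card_mul_index]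
      exact Nat.mul_le_mul_left _ hle
  have bij := (Nat.bijective_iff_injective_and_card _).2 ⟨inj, hcard⟩
  obtain ⟨⟨b, a⟩, hab⟩ := bij.2 1
  have hab : (b : G) * g * a = 1 := hab
  have hg : g ∈ C := by
    have : g = (b : G)⁻¹ * (a : G)⁻¹ := by
      rw [← mul_inv_rev, eq_comm, inv_eq_iff_mul_eq_one]
      have := congrArg (fun t => (a : G) * t * (a : G)⁻¹) hab
      simpa [mul_assoc] using this
    rw [this]
    exact C.mul_mem (C.inv_mem b.2) (C.inv_mem a.2)
  apply hnb
  rw [eq_bot_iff, ← hbot]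
  intro y hy
  exact ⟨hy, sk_mem_cj.2 (C.mul_mem (C.mul_mem (C.inv_mem hg) hy) hg)⟩

theorem sk_fitting {G : Type*} [Group G] [Finite G] (C : Subgroup G) (hcyc : IsCyclic C)
    (hC : C ≠ ⊤) (hle : C.index ≤ Nat.card C) (hnb : C ≠ ⊥) :
    ∃ (p : ℕ) (x : G) (E : Subgroup G), p.Prime ∧ x ∈ C ∧ x ≠ 1 ∧ E.Normal ∧ E ≠ ⊥ ∧
      (∀ e ∈ E, x * e = e * x) ∧ (∀ e ∈ E, ∀ f ∈ E, e * f = f * e) ∧ (∀ e ∈ E, e ^ p = 1) ∧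
      (∀ F : Subgroup G, F.Normal → F ≤ E → F ≠ ⊥ → F = E) := by
  have hcomm : ∀ a ∈ C, ∀ b ∈ C, a * b = b * a := by
    intro a ha b hb
    letI := hcyc.commGroup
    exact congrArg Subtype.val (mul_comm (⟨a, ha⟩ : C) ⟨b, hb⟩)
  obtain ⟨g, -, hg⟩ := Set.exists_min_image (Set.univ : Set G)
    (fun g => Nat.card (C ⊓ sk_cj g C : Subgroup G)) Set.finite_univ ⟨1, trivial⟩
  set M := C ⊓ sk_cj g C with hM
  have hMb : M ≠ ⊥ := sk_meet C hC hle hnb g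
  have hMc : Nat.card M ≠ 1 := by
    rwa [Ne, Subgroup.card_eq_one]
  obtain ⟨p, hp, hpd⟩ := Nat.exists_prime_and_dvd hMc
  haveI : Fact p.Prime := ⟨hp⟩
  obtain ⟨⟨x, hxM⟩, hx⟩ := exists_prime_orderOf_dvd_card' (G := M) p hpd
  rw [Subgroup.orderOf_mk] at hx
  have hx1 : x ≠ 1 := by
    rintro rfl
    rw [orderOf_one] at hx
    exact hp.one_lt.ne hx
  have hcjc : ∀ a ∈ sk_cj g C, ∀ b ∈ sk_cj g C, a * b = b * a := by
    intro a ha b hb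
    rw [sk_mem_cj] at ha hb
    have := hcomm _ ha _ hb
    have h2 : g⁻¹ * (a * b) * g = g⁻¹ * (b * a) * g := by
      simpa [mul_assoc] using this
    simpa using h2
  obtain ⟨N, -, hNp, hNn, hxN⟩ := sk_zenkov p _ ⊤ C (sk_cj g C) rfl le_top le_top hcomm hcjc
    (by
      intro h _
      have e : sk_cj h (sk_cj g C) = sk_cj (h * g) C := by
        ext y; simp [sk_mem_cj, mul_assoc]
      rw [e]
      exact hg _ trivial) x hxM
    (IsPGroup.of_card (n := 1) (by rw [Nat.card_zpowers, hx, pow_one]))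
  let W : Subgroup G :=
    { carrier := {z | z ∈ N ∧ (∀ n ∈ N, n * z = z * n) ∧ z ^ p = 1}
      one_mem' := ⟨N.one_mem, by simp, by simp⟩
      mul_mem' := by
        rintro a b ⟨ha, ha2, ha3⟩ ⟨hb, hb2, hb3⟩
        refine ⟨N.mul_mem ha hb, ?_, ?_⟩
        · intro n hn
          rw [← mul_assoc, ha2 n hn, mul_assoc, hb2 n hn, mul_assoc]
        · have : Commute a b := hb2 a ha
          rw [this.mul_pow, ha3, hb3, one_mul]
      inv_mem' := by
        rintro a ⟨ha, ha2, ha3⟩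
        refine ⟨N.inv_mem ha, ?_, by rw [inv_pow, ha3, inv_one]⟩
        intro n hn
        have : Commute n a := ha2 n hn
        exact this.inv_right }
  have hWn : W.Normal := by
    refine ⟨?_⟩
    rintro a ⟨ha, ha2, ha3⟩ h
    refine ⟨hNn h trivial a ha, ?_, ?_⟩
    · intro n hn
      have h1 := ha2 _ (hNn h⁻¹ trivial n hn)
      have h2 := congrArg (fun t => h * t * h⁻¹) h1
      simpa [mul_assoc] using h2
    · rw [conj_pow, ha3]; simp
  have hWb : W ≠ ⊥ := by
    haveI : Nontrivial N := ⟨⟨x, hxN⟩, 1, fun h => hx1 (congrArg Subtype.val h)⟩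
    have hnt := hNp.center_nontrivial
    have hzp : IsPGroup p (Subgroup.center N) := hNp.to_subgroup _
    have hd : p ∣ Nat.card (Subgroup.center N) := by
      obtain ⟨k, hk⟩ := IsPGroup.iff_card.1 hzp
      rw [hk]
      rcases k with _ | k
      · rw [pow_zero, Nat.card_eq_one_iff_unique] at hk
        exact absurd hk.1 (not_subsingleton_iff_nontrivial.2 hnt)
      · exact dvd_pow_self _ (by simp)
    obtain ⟨z, hz⟩ := exists_prime_orderOf_dvd_card' p hd
    intro hb
    have hzW : ((z : N) : G) ∈ W := by
      refine ⟨z.1.2, ?_, ?_⟩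
      · intro n hn
        have := Subgroup.mem_center_iff.1 z.2 ⟨n, hn⟩
        exact congrArg Subtype.val this
      · have : z ^ p = 1 := by rw [← hz]; exact pow_orderOf_eq_one z
        have := congrArg (fun t : Subgroup.center N => ((t : N) : G)) this
        simpa using this
    rw [hb, Subgroup.mem_bot] at hzW
    have : z = 1 := Subtype.ext (Subtype.ext hzW)
    rw [this, orderOf_one] at hz
    exact hp.one_lt.ne hz
  obtain ⟨E, ⟨hE1, hE2, hE3⟩, hEm⟩ :=
    (Set.toFinite {E : Subgroup G | E.Normal ∧ E ≤ W ∧ E ≠ ⊥}).exists_minimal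
      ⟨W, hWn, le_refl _, hWb⟩
  refine ⟨p, x, E, hp, hxM.1, hx1, hE1, hE3, ?_, ?_, ?_, ?_⟩
  · intro e he
    exact (hE2 he).2.1 x hxN
  · intro e he f hf
    exact (hE2 hf).2.1 e (hE2 he).1
  · intro e he
    exact (hE2 he).2.2
  · intro F hF1 hF2 hF3
    exact le_antisymm hF2 (hEm ⟨hF1, hF2.trans hE2, hF3⟩ hF2)

theorem sk_cyc_map {G G' : Type*} [Group G] [Group G'] (C : Subgroup G) (hC : IsCyclic C)
    (f : G →* G') : IsCyclic (C.map f) :=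
  isCyclic_of_surjective (f.subgroupMap C) (f.subgroupMap_surjective C)

theorem sk_lucchini.{u} : ∀ (n : ℕ) (G : Type u) [Group G] [Finite G] (C : Subgroup G),
    Nat.card G = n → IsCyclic C → C ≠ ⊤ → C.normalCore = ⊥ → Nat.card C < C.index := by
  intro n
  induction n using Nat.strong_induction_on with
  | _ n ih =>
  intro G _ _ C hn hcyc hC hcore
  by_contra hlt
  have hle : C.index ≤ Nat.card C := not_lt.1 hlt
  have hcomm : ∀ a ∈ C, ∀ b ∈ C, a * b = b * a := by
    intro a ha b hb
    letI := hcyc.commGroup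
    exact congrArg Subtype.val (mul_comm (⟨a, ha⟩ : C) ⟨b, hb⟩)
  have hcf : ∀ a, (∀ g, g * a * g⁻¹ ∈ C) → a = 1 := by
    intro a ha
    have : a ∈ C.normalCore := ha
    rwa [hcore, Subgroup.mem_bot] at this
  have hnb : C ≠ ⊥ := by
    rintro rfl
    rw [Subgroup.card_bot] at hle
    have h0 : (⊥ : Subgroup G).index ≠ 0 := Subgroup.index_ne_zero_of_finite
    exact hC (Subgroup.index_eq_one.1 (by omega))
  obtain ⟨p, x, E, hp, hxC, hx1, hEn, hEb, hxE, hEc, hEp, hEm⟩ := sk_fitting C hcyc hC hle hnb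
  haveI : Fact p.Prime := ⟨hp⟩
  have hEC : ¬ E ≤ C := by
    intro h
    apply hEb
    rw [eq_bot_iff, ← hcore]
    exact Subgroup.normal_le_normalCore.2 h
  -- `C ⊔ E` is proper
  have hCE : C ⊔ E ≠ ⊤ := by
    intro htop
    have h1 : C ⊔ E ≤ Subgroup.centralizer {x} := by
      refine sup_le ?_ ?_
      · intro a ha
        rw [Subgroup.mem_centralizer_singleton_iff]
        exact hcomm _ ha _ hxC
      · intro a ha
        rw [Subgroup.mem_centralizer_singleton_iff]
        exact (hxE a ha).symm
    rw [htop] at h1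
    apply hx1
    apply hcf
    intro g
    rw [Subgroup.mem_centralizer_singleton_iff.1 (h1 (Subgroup.mem_top g))]
    simpa using hxC
  set L := (C ⊔ E).normalCore with hL
  have hLn : L.Normal := Subgroup.normalCore_normal _
  have hEL : E ≤ L := Subgroup.normal_le_normalCore.2 le_sup_right
  have hLle : L ≤ C ⊔ E := Subgroup.normalCore_le _
  have hLC : L ⊔ C = C ⊔ E :=
    le_antisymm (sup_le hLle le_sup_left) (sup_le le_sup_right (hEL.trans le_sup_left))
  have hLdec : ∀ l ∈ L, ∃ b ∈ C, b ∈ L ∧ ∃ e ∈ E, l = b * e := by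
    intro l hl
    obtain ⟨b, hb, e, he, rfl⟩ := Subgroup.mem_sup_of_normal_right.1 (hLle hl)
    refine ⟨b, hb, ?_, e, he, rfl⟩
    have := L.mul_mem hl (L.inv_mem (hEL he))
    simpa using this
  have hLb : L ≠ ⊥ := fun h => hEb (by rw [eq_bot_iff, ← h]; exact hEL)
  have hLt : L ≠ ⊤ := fun h => hCE (by rw [eq_top_iff, ← h]; exact hLle)
  -- the quotient
  have hq : Nat.card (C.map (QuotientGroup.mk' L)) < (C ⊔ E).index := by
    have hsurj : Function.Surjective (QuotientGroup.mk' L) := QuotientGroup.mk'_surjective L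
    have hcm : (C.map (QuotientGroup.mk' L)).comap (QuotientGroup.mk' L) = C ⊔ E := by
      rw [QuotientGroup.comap_map_mk', hLC]
    rw [← hcm, Subgroup.index_comap_of_surjective _ hsurj]
    refine ih (Nat.card (G ⧸ L)) ?_ (G ⧸ L) _ rfl ?_ ?_ ?_
    · rw [← hn, ← L.card_mul_index]
      have h1 : 1 < Nat.card L := by
        rw [Subgroup.one_lt_card_iff_ne_bot]; exact hLb
      have h2 : 0 < L.index := Nat.pos_of_ne_zero Subgroup.index_ne_zero_of_finite
      change L.index < _
      nlinarith
    · exact sk_cyc_map C hcyc _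
    · intro h
      rw [h, Subgroup.comap_top] at hcm
      exact hCE hcm.symm
    · rw [eq_bot_iff]
      intro y hy
      obtain ⟨w, rfl⟩ := hsurj y
      have hw : (((C.map (QuotientGroup.mk' L)).normalCore).comap (QuotientGroup.mk' L)) ≤ L := by
        refine Subgroup.normal_le_normalCore.2 ?_
        rw [← hcm]
        exact Subgroup.comap_mono (Subgroup.normalCore_le _)
      have := hw (show w ∈ _ from hy)
      rw [Subgroup.mem_bot]
      exact (QuotientGroup.eq_one_iff w).2 this
  have hB : C.relIndex L < Nat.card (C.subgroupOf L) := by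
    have e1 : Nat.card (C.map (QuotientGroup.mk' L)) * Nat.card (C.subgroupOf L) = Nat.card C := by
      rw [← Subgroup.relIndex_ker, QuotientGroup.ker_mk', mul_comm, Subgroup.relIndex,
        ← (L.subgroupOf C).card_mul_index]
      congr 1
      exact Nat.card_congr ⟨fun y => ⟨⟨y.1.1, y.2⟩, y.1.2⟩, fun y => ⟨⟨y.1.1, y.2⟩, y.1.2⟩,
        fun _ => rfl, fun _ => rfl⟩
    have e2 : C.relIndex (C ⊔ E) * (C ⊔ E).index = C.index :=
      Subgroup.relIndex_mul_index le_sup_left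
    have e3 : C.relIndex L ≤ C.relIndex (C ⊔ E) :=
      Subgroup.relIndex_le_of_le_right hLle Subgroup.index_ne_zero_of_finite
    have e4 : 0 < Nat.card (C.subgroupOf L) := Nat.card_pos
    by_contra hge
    have hge := not_lt.1 hge
    have : Nat.card C < C.index := by
      calc Nat.card C = Nat.card (C.map (QuotientGroup.mk' L)) * Nat.card (C.subgroupOf L) :=
            e1.symm
        _ < (C ⊔ E).index * Nat.card (C.subgroupOf L) := Nat.mul_lt_mul_of_pos_right hq e4
        _ ≤ (C ⊔ E).index * C.relIndex (C ⊔ E) := Nat.mul_le_mul_left _ (hge.trans e3)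
        _ = C.index := by rw [mul_comm, e2]
    exact hlt this
  by_cases hcase : ∀ e ∈ E, ∀ l ∈ L, l * e = e * l
  · -- `L` is abelian
    have hexp : ∀ b ∈ C, b ∈ L → b ^ p = 1 := by
      intro b hb hbL
      apply hcf
      intro g
      obtain ⟨b', hb', hb'L, e, he, h⟩ := hLdec _ (hLn.conj_mem b hbL g)
      rw [← conj_pow, h]
      have hc : Commute b' e := hcase e he b' hb'L
      rw [hc.mul_pow, hEp e he, mul_one]
      exact C.pow_mem hb' p
    have hBle : Nat.card (C.subgroupOf L) ≤ p := by
      have hci : IsCyclic (C.subgroupOf L) := by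
        let f : C.subgroupOf L →* C :=
          { toFun := fun y => ⟨y.1.1, y.2⟩, map_one' := rfl, map_mul' := fun _ _ => rfl }
        exact isCyclic_of_injective f (by
          intro a b hab
          exact Subtype.ext (Subtype.ext (congrArg (fun t : C => (t : G)) hab)))
      obtain ⟨y, hy⟩ := IsCyclic.exists_ofOrder_eq_natCard (α := C.subgroupOf L)
      rw [← hy]
      refine orderOf_le_of_pow_eq_one hp.pos ?_
      exact Subtype.ext (Subtype.ext (hexp _ y.2 y.1.2))
    have hEpg : IsPGroup p E := fun e => ⟨1, Subtype.ext (by simpa using hEp e.1 e.2)⟩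
    obtain ⟨k, hk⟩ := IsPGroup.iff_card.1 hEpg
    have hd := Subgroup.relIndex_dvd_card C E
    rw [hk] at hd
    obtain ⟨j, -, hj⟩ := (Nat.dvd_prime_pow hp).1 hd
    have hlt2 : C.relIndex E < p :=
      ((Subgroup.relIndex_le_of_le_right hEL Subgroup.index_ne_zero_of_finite).trans_lt
        hB).trans_le hBle
    rw [hj] at hlt2
    have hj0 : j = 0 := by
      by_contra hj0
      exact absurd hlt2 (not_lt.2 (Nat.le_self_pow hj0 p))
    rw [hj0, pow_zero, Subgroup.relIndex_eq_one] at hj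
    exact hEC hj
  · -- `Z(L) ∩ E = 1`
    let Z : Subgroup G := L ⊓ Subgroup.centralizer (L : Set G)
    have hZn : Z.Normal := inferInstance
    have hZE : Z ⊓ E = ⊥ := by
      by_contra hne
      have h1 := hEm (Z ⊓ E) inferInstance inf_le_right hne
      apply hcase
      intro e he l hl
      rw [← h1] at he
      exact Subgroup.mem_centralizer_iff.1 he.1.2 l hl
    have hZcyc : IsCyclic Z := by
      have hmem : ∀ z : Z, QuotientGroup.mk' E z.1 ∈ C.map (QuotientGroup.mk' E) := by
        intro z
        obtain ⟨b, hb, -, e, he, h⟩ := hLdec z.1 z.2.1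
        refine ⟨b, hb, ?_⟩
        rw [h, map_mul]
        have : QuotientGroup.mk' E e = 1 := (QuotientGroup.eq_one_iff e).2 he
        rw [this, mul_one]
      let f : Z →* C.map (QuotientGroup.mk' E) :=
        ((QuotientGroup.mk' E).comp Z.subtype).codRestrict _ hmem
      have hmc := sk_cyc_map C hcyc (QuotientGroup.mk' E)
      refine isCyclic_of_injective f ?_
      rw [injective_iff_map_eq_one]
      intro z hz
      have h1 : QuotientGroup.mk' E z.1 = 1 := congrArg Subtype.val hz
      have h2 : z.1 ∈ E := (QuotientGroup.eq_one_iff z.1).1 h1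
      have h3 : z.1 ∈ Z ⊓ E := ⟨z.2, h2⟩
      rw [hZE, Subgroup.mem_bot] at h3
      exact Subtype.ext h3
    have hV : ∀ b ∈ C, b ∈ L → (∀ e ∈ E, b * e = e * b) → b = 1 := by
      intro b hb hbL hbE
      have hbZ : b ∈ Z := by
        refine ⟨hbL, Subgroup.mem_centralizer_iff.2 ?_⟩
        intro l hl
        obtain ⟨b', hb', -, e, he, rfl⟩ := hLdec l hl
        have c1 : Commute b' b := hcomm _ hb' _ hb
        have c2 : Commute e b := (hbE e he).symm
        exact c1.mul_left c2
      apply hcf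
      intro g
      obtain ⟨m, hm⟩ := MonoidHom.map_cyclic (MulAut.conjNormal (H := Z) g).toMonoidHom
      have := congrArg Subtype.val (hm ⟨b, hbZ⟩)
      have h2 : g * b * g⁻¹ = b ^ m := by simpa using this
      rw [h2]
      exact C.zpow_mem hb m
    have hfin : Nat.card (C.subgroupOf L) < (C.subgroupOf L).index := by
      refine ih (Nat.card L) ?_ L _ rfl ?_ ?_ ?_
      · rw [← hn]
        by_contra hge
        exact hLt (Subgroup.eq_top_of_le_card _ (not_lt.1 hge))
      · let f : C.subgroupOf L →* C :=
          { toFun := fun y => ⟨y.1.1, y.2⟩, map_one' := rfl, map_mul' := fun _ _ => rfl }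
        exact isCyclic_of_injective f (by
          intro a b hab
          exact Subtype.ext (Subtype.ext (congrArg (fun t : C => (t : G)) hab)))
      · rw [Ne, Subgroup.subgroupOf_eq_top]
        exact fun h => hEC (hEL.trans h)
      · rw [eq_bot_iff]
        intro u hu
        rw [Subgroup.mem_bot]
        have hu' : ∀ l : L, l * u * l⁻¹ ∈ C.subgroupOf L := hu
        have huC : u.1 ∈ C := by
          have := hu' 1
          rw [one_mul, inv_one, mul_one] at this
          exact this
        refine Subtype.ext (hV u.1 huC u.2 ?_)
        intro e he
        have hk : u.1 * (e * u.1⁻¹ * e⁻¹) = 1 := by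
          have h1 : u.1 * (e * u.1⁻¹ * e⁻¹) ∈ C := by
            refine C.mul_mem huC ?_
            have := C.inv_mem (hu' ⟨e, hEL he⟩)
            simpa [mul_assoc] using this
          have h2 : u.1 * (e * u.1⁻¹ * e⁻¹) ∈ E := by
            have := E.mul_mem (hEn.conj_mem e he u.1) (E.inv_mem he)
            simpa [mul_assoc] using this
          exact hV _ h1 (hEL h2) (fun f hf => hEc _ h2 f hf)
        have := congrArg (fun t => t * e * u.1) hk
        simpa [mul_assoc] using this
    exact absurd hfin (not_lt.2 hB.le)

theorem sk_order_lt {A : Type*} [Group A] [Fintype A] [Nontrivial A]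
    (φ : Equiv.Perm A) (π : A → ℤ) (h : IsSkewMorphism φ π) : orderOf φ < Nat.card A := by
  obtain ⟨h1, h2⟩ := h
  have hrel : ∀ a, φ * Equiv.mulLeft a = Equiv.mulLeft (φ a) * φ ^ π a := by
    intro a; ext b; simpa using h2 a b
  let G : Subgroup (Equiv.Perm A) := Subgroup.closure ({φ} ∪ Set.range Equiv.mulLeft)
  have hφ : φ ∈ G := Subgroup.subset_closure (Or.inl rfl)
  have hLm : ∀ a, Equiv.mulLeft a ∈ G := fun a => Subgroup.subset_closure (Or.inr ⟨a, rfl⟩)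
  have hform : ∀ g ∈ G, ∃ (a : A) (i : ℤ), g = Equiv.mulLeft a * φ ^ i := by
    intro g hg
    induction hg using Subgroup.closure_induction_left with
    | one => exact ⟨1, 0, by ext; simp⟩
    | mul_left x hx y hy ih =>
      obtain ⟨b, i, rfl⟩ := ih
      rcases hx with hx | ⟨a, rfl⟩
      · rw [Set.mem_singleton_iff] at hx
        subst hx
        exact ⟨x b, π b + i, by rw [← mul_assoc, hrel, mul_assoc, zpow_add]⟩
      · exact ⟨a * b, i, by ext; simp [mul_assoc]⟩
    | inv_mul_cancel x hx y hy ih =>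
      obtain ⟨b, i, rfl⟩ := ih
      rcases hx with hx | ⟨a, rfl⟩
      · rw [Set.mem_singleton_iff] at hx
        subst hx
        obtain ⟨a, rfl⟩ := x.surjective b
        refine ⟨a, - π a + i, ?_⟩
        rw [inv_mul_eq_iff_eq_mul, ← mul_assoc, hrel, mul_assoc, ← zpow_add]
        simp
      · refine ⟨a⁻¹ * b, i, ?_⟩
        rw [inv_mul_eq_iff_eq_mul]
        ext; simp [mul_assoc]
  let f : G := ⟨φ, hφ⟩
  let C : Subgroup G := Subgroup.zpowers f
  have hfix : ∀ c ∈ C, (c : Equiv.Perm A) 1 = 1 := by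
    rintro _ ⟨i, rfl⟩
    exact Function.IsFixedPt.perm_zpow (e := φ) h1 i
  have hlt : Nat.card C < C.index := by
    refine sk_lucchini _ G C rfl inferInstance ?_ ?_
    · intro htop
      obtain ⟨a, ha⟩ := exists_ne (1 : A)
      have := hfix ⟨Equiv.mulLeft a, hLm a⟩ (by rw [htop]; trivial)
      apply ha
      simpa using this
    · rw [eq_bot_iff]
      intro c hc
      have hc' : ∀ g : G, g * c * g⁻¹ ∈ C := hc
      rw [Subgroup.mem_bot]
      apply Subtype.ext
      ext a
      have := hfix _ (hc' ⟨Equiv.mulLeft a, hLm a⟩⁻¹)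
      have h3 : a⁻¹ * (c : Equiv.Perm A) a = 1 := by simpa using this
      exact (inv_mul_eq_one.1 h3).symm
  have hidx : C.index ≤ Nat.card A := by
    refine Nat.card_le_card_of_surjective
      (fun a : A => ((⟨Equiv.mulLeft a, hLm a⟩ : G) : G ⧸ C)) ?_
    intro q
    obtain ⟨⟨g, hg⟩, rfl⟩ := QuotientGroup.mk_surjective q
    obtain ⟨a, i, rfl⟩ := hform g hg
    refine ⟨a, QuotientGroup.eq.2 ⟨i, ?_⟩⟩
    apply Subtype.ext
    exact (inv_mul_cancel_left (Equiv.mulLeft a) (φ ^ i)).symm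
  have hcard : Nat.card C = orderOf φ := by
    rw [Nat.card_zpowers]
    exact Subgroup.orderOf_mk φ hφ
  omega

theorem stmt2 {A : Type*} [Group A] [Fintype A] [Nontrivial A]
    (φ : Equiv.Perm A) (π : A → ℤ) (h : IsSkewMorphism φ π) :
    ∃ x : A, x ≠ 1 ∧ π x ≡ 1 [ZMOD (orderOf φ)] := by
  have hlt := sk_order_lt φ π h
  obtain ⟨h1, h2⟩ := h
  have hpos : 0 < orderOf φ := orderOf_pos φ
  haveI : NeZero (orderOf φ) := ⟨hpos.ne'⟩
  have hninj : ¬ Function.Injective (fun a => ((π a : ℤ) : ZMod (orderOf φ))) := by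
    intro hinj
    have := Nat.card_le_card_of_injective _ hinj
    rw [Nat.card_zmod] at this
    omega
  rw [Function.not_injective_iff] at hninj
  obtain ⟨a, b, hab, hne⟩ := hninj
  have hab' : π a ≡ π b [ZMOD (orderOf φ)] := (ZMod.intCast_eq_intCast_iff _ _ _).1 hab
  have hpow : φ ^ π a = φ ^ π b := zpow_eq_zpow_iff_modEq.2 hab'
  have key : ∀ c, φ (a * b⁻¹ * c) = φ a * (φ b)⁻¹ * φ c := by
    intro c
    have e1 := h2 a (b⁻¹ * c)
    have e2 := h2 b (b⁻¹ * c)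
    rw [mul_inv_cancel_left] at e2
    rw [mul_assoc, e1, e2, hpow]
    group
  refine ⟨a * b⁻¹, fun hh => hne (mul_inv_eq_one.1 hh), ?_⟩
  rw [← zpow_eq_zpow_iff_modEq (x := φ), zpow_one]
  ext c
  have k1 := key c
  have k2 := key 1
  rw [h1, mul_one, mul_one] at k2
  rw [h2, k2] at k1
  exact mul_left_cancel k1
end

section
/- If p is a prime number, then every skew morphism of the cyclic group ℤ_p is an automorphism of ℤ_p. -/
def IsAddSkewMorphism {A : Type*} [AddGroup A] (φ : Equiv.Perm A) (π : A → ℤ) : Prop :=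
  φ 0 = 0 ∧ ∀ x y : A, φ (x + y) = φ x + (φ ^ π x) y

def IsAddSmooth {A : Type*} [AddGroup A] (φ : Equiv.Perm A) (π : A → ℤ) : Prop :=
  ∀ x : A, π (φ x) ≡ π x [ZMOD (orderOf φ)]

theorem skew_iter {A : Type*} [AddGroup A] (φ : Equiv.Perm A) (π : A → ℤ)
    (h : IsAddSkewMorphism φ π) (n : ℕ) (a : A) :
    ∃ s : ℤ, ∀ b, (φ ^ n) (a + b) = (φ ^ n) a + (φ ^ s) b := by
  induction n with
  | zero => exact ⟨0, fun b => by simp⟩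
  | succ n ih =>
    obtain ⟨s, hs⟩ := ih
    refine ⟨π ((φ ^ n) a) + s, fun b => ?_⟩
    rw [pow_succ', Equiv.Perm.mul_apply, hs, h.2, zpow_add, Equiv.Perm.mul_apply,
      Equiv.Perm.mul_apply]

theorem zmod_nsmul_gen (p : ℕ) [Fact p.Prime] (c : ZMod p) (hc : c ≠ 0) (y : ZMod p) :
    ∃ n : ℕ, y = n • c := by
  refine ⟨(y / c).val, ?_⟩
  rw [nsmul_eq_mul, ZMod.natCast_zmod_val, div_mul_cancel₀ _ hc]

theorem skew_order_lt (p : ℕ) [Fact p.Prime]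
    (φ : Equiv.Perm (ZMod p)) (π : ZMod p → ℤ) (h : IsAddSkewMorphism φ π) :
    orderOf φ < p := by
  have hpos : 0 < orderOf φ := orderOf_pos φ
  have hfix0 : ∀ n : ℕ, (φ ^ n) 0 = 0 := fun n => by
    induction n with
    | zero => simp
    | succ n ih => rw [pow_succ', Equiv.Perm.mul_apply, ih, h.1]
  set k := Function.minimalPeriod φ (1 : ZMod p) with hk
  have hkm : k ∣ orderOf φ := by
    apply Function.IsPeriodicPt.minimalPeriod_dvd
    rw [Function.IsPeriodicPt, Function.IsFixedPt, ← Equiv.Perm.coe_pow, pow_orderOf_eq_one]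
    rfl
  have hkpos : 0 < k := Nat.pos_of_dvd_of_pos hkm hpos
  have hk1 : (φ ^ k) 1 = 1 := by
    rw [Equiv.Perm.coe_pow]
    exact Function.iterate_minimalPeriod
  obtain ⟨q, hq⟩ := hkm
  have hq0 : q ≠ 0 := by rintro rfl; omega
  obtain ⟨s, hs⟩ := skew_iter φ π h k 1
  rw [hk1] at hs
  have hsq : (φ ^ s) ^ q = 1 := by
    have hconj : ∀ n : ℕ, ∀ b, ((φ ^ k) ^ n) (1 + b) = 1 + ((φ ^ s) ^ n) b := by
      intro n
      induction n with
      | zero => intro b; simp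
      | succ n ih =>
        intro b
        rw [pow_succ, Equiv.Perm.mul_apply, hs, ih, pow_succ, Equiv.Perm.mul_apply]
    ext1 b
    have := hconj q b
    rw [← pow_mul, ← hq, pow_orderOf_eq_one] at this
    simpa using this.symm
  have hks : (k : ℤ) ∣ s := by
    rw [← zpow_natCast, ← zpow_mul] at hsq
    have := orderOf_dvd_iff_zpow_eq_one.2 hsq
    rw [hq] at this
    push_cast at this
    exact Int.dvd_of_mul_dvd_mul_right (by exact_mod_cast hq0) this
  obtain ⟨t, rfl⟩ := hks
  have hall : ∀ n : ℕ, (φ ^ k) (n : ZMod p) = n := by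
    intro n
    induction n with
    | zero => simpa using hfix0 k
    | succ n ih =>
      rw [Nat.cast_succ]
      rw [add_comm, hs, zpow_mul, zpow_natCast,
        Function.IsFixedPt.perm_zpow (e := φ ^ k) ih t]
  have hone : φ ^ k = 1 := by
    ext1 y
    have := hall y.val
    simpa using this
  have hle : orderOf φ ≤ k := orderOf_le_of_pow_eq_one hkpos hone
  have hinj := Function.iterate_injOn_Iio_minimalPeriod (f := φ) (x := (1 : ZMod p))
  have hcard : (Finset.range k).card ≤ (Finset.univ.erase (0 : ZMod p)).card := by
    apply Finset.card_le_card_of_injOn (fun n => φ^[n] (1 : ZMod p))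
    · intro n _
      simp only [Finset.coe_erase, Finset.coe_univ, Set.mem_sdiff, Set.mem_univ,
        Set.mem_singleton_iff, true_and]
      rw [← Equiv.Perm.coe_pow]
      intro h0
      rw [← hfix0 n] at h0
      exact one_ne_zero ((φ ^ n).injective h0)
    · intro a ha b hb hab
      exact hinj (by simpa using ha) (by simpa using hb) hab
  rw [Finset.card_range, Finset.card_erase_of_mem (Finset.mem_univ _), Finset.card_univ,
    ZMod.card] at hcard
  have := (Fact.out : p.Prime).pos
  omega

theorem stmt3 (p : ℕ) (hp : p.Prime)
    (φ : Equiv.Perm (ZMod p)) (π : ZMod p → ℤ) (h : IsAddSkewMorphism φ π) :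
    ∀ a b : ZMod p, φ (a + b) = φ a + φ b := by
  have : Fact p.Prime := ⟨hp⟩
  have hlt := skew_order_lt p φ π h
  have : NeZero (orderOf φ) := ⟨(orderOf_pos φ).ne'⟩
  obtain ⟨a, b, hab, he⟩ := Fintype.exists_ne_map_eq_of_card_lt
    (fun x : ZMod p => ((π x : ℤ) : ZMod (orderOf φ))) (by simpa [ZMod.card] using hlt)
  have hpow : φ ^ π a = φ ^ π b :=
    zpow_eq_zpow_iff_modEq.2 ((ZMod.intCast_eq_intCast_iff _ _ _).1 he)
  have hc : b - a ≠ 0 := sub_ne_zero.2 hab.symm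
  have key : ∀ y, φ ((b - a) + y) = φ b - φ a + φ y := by
    intro y
    have h1 := h.2 a (y - a)
    have h2 := h.2 b (y - a)
    rw [hpow] at h1
    rw [show a + (y - a) = y by ring] at h1
    rw [show b + (y - a) = b - a + y by ring] at h2
    rw [h1, h2]; ring
  have key2 : ∀ (n : ℕ) y, φ (n • (b - a) + y) = n • (φ b - φ a) + φ y := by
    intro n
    induction n with
    | zero => intro y; simp
    | succ n ih => intro y; rw [succ_nsmul, add_assoc, ih, key, succ_nsmul, add_assoc]
  intro x y
  obtain ⟨n, rfl⟩ := zmod_nsmul_gen p _ hc x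
  have h0 := key2 n 0
  rw [add_zero, h.1, add_zero] at h0
  rw [key2, h0]
end

section
/- Every skew morphism of the cyclic group ℤ_n is smooth if and only if n = 2^e·n₁ where 0 ≤ e ≤ 4 and n₁ is an odd square-free number. -/
namespace SkewAux
/-! ### Construction of non-smooth skew morphisms -/

/-- the triangular number `x (x - 1) / 2` -/
def tri (x : ℤ) : ℤ := x * (x - 1) / 2

lemma two_tri (x : ℤ) : 2 * tri x = x * (x - 1) := by
  unfold tri
  rw [Int.mul_ediv_cancel']
  have := Int.even_mul_pred_self x
  exact this.two_dvd

lemma tri_add (x y : ℤ) : tri (x + y) = tri x + tri y + x * y := by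
  have h1 := two_tri (x + y)
  have h2 := two_tri x
  have h3 := two_tri y
  have : 2 * tri (x + y) = 2 * (tri x + tri y + x * y) := by
    rw [h1, mul_add, mul_add, h2, h3]; ring
  linarith

lemma tri_neg (x : ℤ) : tri (-x) = tri x + x := by
  have h1 := two_tri (-x)
  have h2 := two_tri x
  have : 2 * tri (-x) = 2 * (tri x + x) := by
    rw [h1, mul_add, h2]; ring
  linarith

theorem exists_nonsmooth (n m r : ℕ) (hn : 0 < n) (hnm : n = m * r) (hr : r ∣ m)
    (hr2 : ¬ r ∣ 2)
    (hq : ∀ s : ℤ, (r : ℤ) ∣ tri (m * s)) :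
    ∃ (φ : Equiv.Perm (ZMod n)) (π : ZMod n → ℤ),
      IsAddSkewMorphism φ π ∧ ¬ IsAddSmooth φ π := by
  have : NeZero n := ⟨hn.ne'⟩
  set F : ℤ → ℤ := fun x => -x - m * tri x with hF
  -- basic congruences
  have hz : ∀ a : ℤ, (r : ℤ) ∣ a → ((m * a : ℤ) : ZMod n) = 0 := by
    intro a ha
    rw [ZMod.intCast_zmod_eq_zero_iff_dvd]
    rw [hnm]; push_cast
    exact mul_dvd_mul_left _ ha
  have hmm : (m : ZMod n) * m = 0 := by
    have := hz m (by exact_mod_cast hr)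
    push_cast at this; exact this
  -- m * tri is invariant under shifting by multiples of m
  have hsh : ∀ x s : ℤ, (m : ZMod n) * (tri (x + m * s) : ℤ) = m * (tri x : ℤ) := by
    intro x s
    rw [tri_add]
    have h1 := hz _ (hq s)
    push_cast at h1 ⊢
    linear_combination h1 + (x : ZMod n) * s * hmm
  have hcong : ∀ x y : ℤ, (x : ZMod n) = y → (F x : ZMod n) = F y := by
    intro x y hxy
    rw [ZMod.intCast_eq_intCast_iff_dvd_sub] at hxy
    obtain ⟨k, hk⟩ := hxy
    have hy : y = x + m * (r * k) := by
      have : (n : ℤ) = m * r := by exact_mod_cast hnm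
      rw [this] at hk; linarith
    have h1 := hsh x (r * k)
    have h2 : ((n : ℤ) : ZMod n) = 0 := by simp
    have h3 : (m : ZMod n) * r = 0 := by
      have : ((m * r : ℕ) : ZMod n) = 0 := by rw [← hnm]; simp
      push_cast at this; exact this
    rw [← hy] at h1
    simp only [hF]
    push_cast
    rw [h1, hy]
    push_cast
    linear_combination (k : ZMod n) * h3
  set f : ZMod n → ZMod n := fun x => (F (x.val : ℤ) : ZMod n) with hf
  have hfc : ∀ z : ℤ, f (z : ZMod n) = (F z : ZMod n) := by
    intro z
    apply hcong
    simp
  have hrep : ∀ x : ZMod n, ∃ z : ℤ, (z : ZMod n) = x := fun x => ⟨x.val, by simp⟩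
  have hff : ∀ x : ZMod n, f (f x) = x - m * x := by
    intro x
    obtain ⟨z, rfl⟩ := hrep x
    rw [hfc z, hfc (F z)]
    have h1 := hsh (-z) (- tri z)
    have e : F z = -z + m * (- tri z) := by simp only [hF]; ring
    have e2 : F (F z) = - (F z) - m * tri (F z) := rfl
    rw [e2, e]
    push_cast
    rw [h1, tri_neg]
    push_cast
    ring
  have hinj : Function.Injective f := by
    intro x y hxy
    have h1 := hff x
    have h2 := hff y
    rw [hxy, h2] at h1
    linear_combination (-(1 + (m : ZMod n))) * h1 + (x - y) * hmm
  set φ : Equiv.Perm (ZMod n) := Equiv.ofBijective f (Finite.injective_iff_bijective.mp hinj)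
    with hφ
  have hφf : ∀ x, φ x = f x := fun x => rfl
  have hpow : ∀ (i : ℕ) (x : ZMod n), (φ ^ (2 * i)) x = x - i * m * x := by
    intro i
    induction i with
    | zero => intro x; simp
    | succ i ih =>
      intro x
      have : 2 * (i + 1) = 2 * i + 2 := by ring
      rw [this, pow_add, Equiv.Perm.mul_apply, ih, pow_two, Equiv.Perm.mul_apply, hφf, hφf, hff]
      push_cast
      linear_combination (i * x : ZMod n) * hmm
  set π : ZMod n → ℤ := fun x => ((1 + 2 * (n - x.val) : ℕ) : ℤ) with hπ
  have hπpow : ∀ x y : ZMod n, (φ ^ π x) y = φ (y + x * m * y) := by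
    intro x y
    simp only [hπ]
    rw [zpow_natCast, pow_add, pow_one, Equiv.Perm.mul_apply, hpow]
    congr 1
    have : ((n - x.val : ℕ) : ZMod n) = - x := by
      rw [Nat.cast_sub (ZMod.val_lt x).le]; simp
    rw [this]; ring
  refine ⟨φ, π, ⟨?_, ?_⟩, ?_⟩
  · have := hfc 0
    rw [hφf]
    simpa [hF, tri] using this
  · intro x y
    rw [hπpow]
    obtain ⟨x, rfl⟩ := hrep x
    obtain ⟨y, rfl⟩ := hrep y
    have e1 : (x : ZMod n) + y = ((x + y : ℤ) : ZMod n) := by push_cast; rfl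
    have e2 : (y : ZMod n) + x * m * y = ((y + m * (x * y) : ℤ) : ZMod n) := by push_cast; ring
    rw [e1, e2, hφf, hφf, hφf, hfc, hfc, hfc]
    have h1 := hsh y (x * y)
    simp only [hF]
    push_cast
    rw [h1, tri_add]
    push_cast
    ring
  · intro hs
    have h1 := hs 1
    have hφ1 : φ 1 = -1 := by
      have := hfc 1
      rw [hφf]
      simpa [hF, tri] using this
    rw [← zpow_eq_zpow_iff_modEq, hφ1] at h1
    have h2 := congrArg (fun g : Equiv.Perm (ZMod n) => g 1) h1
    simp only [hπpow] at h2
    have h3 := φ.injective h2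
    have h4 : ((2 * m : ℕ) : ZMod n) = 0 := by
      push_cast
      linear_combination -h3
    rw [ZMod.natCast_eq_zero_iff, hnm, mul_comm 2 m] at h4
    have hm : 0 < m := Nat.pos_of_ne_zero (by rintro rfl; simp at hnm; omega)
    exact hr2 (Nat.dvd_of_mul_dvd_mul_left hm h4)

theorem nonsmooth_odd (n p : ℕ) (hn : 0 < n) (hp : p.Prime) (hp2 : p ≠ 2) (h : p * p ∣ n) :
    ∃ (φ : Equiv.Perm (ZMod n)) (π : ZMod n → ℤ),
      IsAddSkewMorphism φ π ∧ ¬ IsAddSmooth φ π := by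
  obtain ⟨k, rfl⟩ := h
  refine exists_nonsmooth _ (p * k) p hn (by ring) (dvd_mul_right _ _) ?_ ?_
  · intro h
    have := (Nat.prime_dvd_prime_iff_eq hp Nat.prime_two).mp h
    exact hp2 this
  · intro s
    have h2 : (p : ℤ) ∣ 2 * tri ((p * k : ℕ) * s) := by
      rw [two_tri]; push_cast
      exact Dvd.intro (k * s * (p * k * s - 1)) (by ring)
    refine IsCoprime.dvd_of_dvd_mul_left ?_ h2
    have := (Nat.coprime_primes hp Nat.prime_two).mpr hp2
    exact_mod_cast Nat.isCoprime_iff_coprime.mpr this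

theorem nonsmooth_two (n : ℕ) (hn : 0 < n) (h : 32 ∣ n) :
    ∃ (φ : Equiv.Perm (ZMod n)) (π : ZMod n → ℤ),
      IsAddSkewMorphism φ π ∧ ¬ IsAddSmooth φ π := by
  obtain ⟨k, rfl⟩ := h
  refine exists_nonsmooth _ (8 * k) 4 hn (by ring) ⟨2 * k, by ring⟩ (by norm_num) ?_
  intro s
  have h2 := two_tri ((8 * k : ℕ) * s)
  refine ⟨k * s * ((8 * k : ℕ) * s - 1), ?_⟩
  push_cast at h2 ⊢
  linarith
end SkewAux
namespace SkewAux
/-! ### General facts on cyclic groups -/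

@[to_additive]
lemma mem_zpowers_of_pow_eq_one {G : Type*} [Group G] [Finite G] [IsCyclic G] (u v : G)
    (h : v ^ orderOf u = 1) : v ∈ Subgroup.zpowers u := by
  classical
  have := Fintype.ofFinite G
  have h1 := IsCyclic.card_pow_eq_one_le (α := G) (n := orderOf u) (orderOf_pos u)
  have h2 : (Finset.univ.filter (fun a : G => a ∈ Subgroup.zpowers u)) ⊆
      Finset.univ.filter (fun a : G => a ^ orderOf u = 1) := by
    intro a ha
    simp only [Finset.mem_filter, Finset.mem_univ, true_and] at ha ⊢
    obtain ⟨k, rfl⟩ := ha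
    simp only
    rw [← zpow_natCast, ← zpow_mul, mul_comm, zpow_mul, zpow_natCast, pow_orderOf_eq_one, one_zpow]
  have h3 : (Finset.univ.filter (fun a : G => a ∈ Subgroup.zpowers u)).card = orderOf u := by
    rw [← Nat.card_zpowers u, Nat.card_eq_fintype_card, Fintype.card_subtype]
  have h4 := Finset.eq_of_subset_of_card_le h2 (by rw [h3]; exact h1)
  have h5 : v ∈ Finset.univ.filter (fun a : G => a ^ orderOf u = 1) := by simpa using h
  rw [← h4] at h5
  simpa using h5

lemma mem_zpowers_of_mem {G : Type*} [Group G] [Finite G] {g u v : G}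
    (hu : u ∈ Subgroup.zpowers g) (hv : v ∈ Subgroup.zpowers g)
    (h : v ^ orderOf u = 1) : v ∈ Subgroup.zpowers u := by
  have := mem_zpowers_of_pow_eq_one (G := Subgroup.zpowers g) ⟨u, hu⟩ ⟨v, hv⟩
    (by ext; simpa using h)
  obtain ⟨k, hk⟩ := this
  exact ⟨k, by simpa using congrArg Subtype.val hk⟩

lemma comm_of_mem {G : Type*} [Group G] {g u v : G}
    (hu : u ∈ Subgroup.zpowers g) (hv : v ∈ Subgroup.zpowers g) : u * v = v * u := by
  obtain ⟨i, rfl⟩ := hu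
  obtain ⟨j, rfl⟩ := hv
  simp only [← zpow_add, add_comm]

lemma exists_pow_of_mem {G : Type*} [Group G] [Finite G] {g u : G}
    (hu : u ∈ Subgroup.zpowers g) : ∃ k : ℕ, g ^ k = u :=
  ((isOfFinOrder_of_finite g).mem_powers_iff_mem_zpowers.mpr hu)

section
variable {A : Type*} [AddCommGroup A]

/-! ### The cocycle attached to a permutation -/

/-- the permutation `y ↦ ψ (x + y) - ψ x` -/
def cj (ψ : Equiv.Perm A) (x : A) : Equiv.Perm A where
  toFun y := ψ (x + y) - ψ x
  invFun y := ψ.symm (y + ψ x) - x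
  left_inv y := by simp
  right_inv y := by simp

lemma cj_apply (ψ : Equiv.Perm A) (x y : A) : cj ψ x y = ψ (x + y) - ψ x := rfl

lemma map_add_cj (ψ : Equiv.Perm A) (x y : A) : ψ (x + y) = ψ x + cj ψ x y := by
  rw [cj_apply]; abel

lemma cj_mul (ψ χ : Equiv.Perm A) (x : A) : cj (ψ * χ) x = cj ψ (χ x) * cj χ x := by
  ext y
  simp [cj_apply]

lemma cj_add (ψ : Equiv.Perm A) (x y : A) : cj ψ (x + y) = cj (cj ψ x) y := by
  ext z
  simp [cj_apply, add_assoc]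

lemma cj_zero {ψ : Equiv.Perm A} (h : ψ 0 = 0) : cj ψ 0 = ψ := by
  ext y
  simp [cj_apply, h]

@[simp] lemma cj_at_zero (ψ : Equiv.Perm A) (x : A) : cj ψ x 0 = 0 := by
  simp [cj_apply]

@[simp] lemma cj_one (x : A) : cj (1 : Equiv.Perm A) x = 1 := by
  ext y
  simp [cj_apply]

lemma eq_one_of_cj {ψ : Equiv.Perm A} (h : ψ 0 = 0) {x : A} (hx : cj ψ x = 1) : ψ = 1 := by
  rw [← cj_zero h, ← add_neg_cancel x, cj_add, hx, cj_one]

/-- skew morphisms, in terms of `cj` -/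
structure Sk (φ : Equiv.Perm A) : Prop where
  zero : φ 0 = 0
  cjm : ∀ x, cj φ x ∈ Subgroup.zpowers φ

namespace Sk
variable {φ : Equiv.Perm A}

/-- the kernel of a skew morphism -/
def K (h : Sk φ) : AddSubgroup A where
  carrier := {x | cj φ x = φ}
  zero_mem' := cj_zero h.zero
  add_mem' := by
    intro x y hx hy
    simp only [Set.mem_ofPred_eq] at *
    rw [cj_add, hx, hy]
  neg_mem' := by
    intro x hx
    simp only [Set.mem_ofPred_eq] at *
    have := cj_zero h.zero
    rw [← add_neg_cancel x, cj_add, hx] at this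
    exact this

lemma mem_K (h : Sk φ) {x : A} : x ∈ h.K ↔ cj φ x = φ := Iff.rfl

lemma apply_zero (h : Sk φ) {ψ : Equiv.Perm A} (hψ : ψ ∈ Subgroup.zpowers φ) : ψ 0 = 0 := by
  obtain ⟨k, rfl⟩ := hψ
  exact Function.IsFixedPt.perm_zpow (e := φ) h.zero k

variable [Finite A]

lemma cj_mem (h : Sk φ) {ψ : Equiv.Perm A} (hψ : ψ ∈ Subgroup.zpowers φ) (x : A) :
    cj ψ x ∈ Subgroup.zpowers φ := by
  obtain ⟨k, rfl⟩ := exists_pow_of_mem hψ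
  clear hψ
  induction k generalizing x with
  | zero => rw [pow_zero, cj_one]; exact one_mem _
  | succ k ih =>
    rw [pow_succ, cj_mul]
    exact mul_mem (ih _) (h.cjm x)

lemma map_K (h : Sk φ) {x : A} (hx : x ∈ h.K) : φ x ∈ h.K := by
  have key : ∀ y, cj φ y x = φ x := by
    intro y
    have h1 := map_add_cj φ x y
    have h2 := map_add_cj φ y x
    rw [h.mem_K.mp hx] at h1
    rw [add_comm y x, h1, add_comm] at h2
    exact (add_left_cancel h2).symm
  have h2 : ∀ y, φ (φ y + φ x) = φ (φ y) + φ (φ x) := by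
    intro y
    have e : (cj φ (φ y)) (φ x) = φ (φ x) := by
      have := comm_of_mem (h.cjm (φ y)) (Subgroup.mem_zpowers φ)
      have := congrArg (fun g : Equiv.Perm A => g x) this
      simp only [Equiv.Perm.mul_apply] at this
      rw [this, key]
    rw [map_add_cj, e]
  rw [mem_K]
  ext y
  obtain ⟨y, rfl⟩ := φ.surjective y
  rw [cj_apply, add_comm, h2]
  abel

lemma K_aux (h : Sk φ) {ψ : Equiv.Perm A} (hψ : ψ ∈ Subgroup.zpowers φ) {x : A} (hx : x ∈ h.K) :
    ψ x ∈ h.K ∧ cj ψ x = ψ := by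
  obtain ⟨k, rfl⟩ := exists_pow_of_mem hψ
  clear hψ
  induction k generalizing x with
  | zero => simpa using hx
  | succ k ih =>
    have h1 := ih (h.map_K hx)
    rw [pow_succ, cj_mul, Equiv.Perm.mul_apply, h1.2, h.mem_K.mp hx]
    exact ⟨h1.1, rfl⟩

lemma add_K (h : Sk φ) {ψ : Equiv.Perm A} (hψ : ψ ∈ Subgroup.zpowers φ) {x : A} (hx : x ∈ h.K)
    (y : A) : ψ (x + y) = ψ x + ψ y := by
  rw [map_add_cj, (h.K_aux hψ hx).2]

lemma add_K' (h : Sk φ) {ψ : Equiv.Perm A} (hψ : ψ ∈ Subgroup.zpowers φ) {x : A} (hx : x ∈ h.K)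
    (y : A) : ψ (y + x) = ψ y + ψ x := by
  rw [add_comm, h.add_K hψ hx, add_comm]

lemma cj_apply_K (h : Sk φ) {ψ : Equiv.Perm A} (hψ : ψ ∈ Subgroup.zpowers φ) {x : A}
    (hx : x ∈ h.K) (y : A) : cj ψ y x = ψ x := by
  rw [cj_apply, h.add_K' hψ hx]; abel

lemma cj_congr (h : Sk φ) {ψ : Equiv.Perm A} (hψ : ψ ∈ Subgroup.zpowers φ) {x y : A}
    (hx : x - y ∈ h.K) : cj ψ x = cj ψ y := by
  have := cj_add ψ (x - y) y
  rw [(h.K_aux hψ hx).2, sub_add_cancel] at this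
  exact this

lemma map_sub_K (h : Sk φ) {ψ : Equiv.Perm A} (hψ : ψ ∈ Subgroup.zpowers φ) {x y : A}
    (hx : x - y ∈ h.K) : ψ x - ψ y ∈ h.K := by
  have := h.add_K hψ hx y
  rw [sub_add_cancel] at this
  rw [this, add_sub_cancel_right]
  exact (h.K_aux hψ hx).1

lemma map_sub_K_iff (h : Sk φ) {ψ : Equiv.Perm A} (hψ : ψ ∈ Subgroup.zpowers φ) {x y : A} :
    ψ x - ψ y ∈ h.K ↔ x - y ∈ h.K := by
  refine ⟨fun hx => ?_, h.map_sub_K hψ⟩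
  simpa using h.map_sub_K (inv_mem hψ) hx

lemma map_K_iff (h : Sk φ) {ψ : Equiv.Perm A} (hψ : ψ ∈ Subgroup.zpowers φ) {x : A} :
    ψ x ∈ h.K ↔ x ∈ h.K := by
  have := h.map_sub_K_iff hψ (x := x) (y := 0)
  simpa [h.apply_zero hψ] using this

/-- powers of `φ` are additive on multiples of elements of `K` -/
lemma nsmul_K (h : Sk φ) {ψ : Equiv.Perm A} (hψ : ψ ∈ Subgroup.zpowers φ) {x : A} (hx : x ∈ h.K)
    (i : ℕ) : ψ (i • x) = i • ψ x := by
  induction i with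
  | zero => simpa using h.apply_zero hψ
  | succ i ih => rw [succ_nsmul, h.add_K' hψ hx, ih, succ_nsmul]

/-- an element of `⟨φ⟩` fixing a generator is trivial -/
lemma eq_one_of_fix (h : Sk φ) {a : A} (ha : ∀ x, x ∈ AddSubgroup.zmultiples a)
    {ψ : Equiv.Perm A} (hψ : ψ ∈ Subgroup.zpowers φ) (hfix : ψ a = a) : ψ = 1 := by
  have hpf : ∀ i : ℕ, (ψ ^ i) a = a := fun i => by
    exact Function.IsFixedPt.perm_pow (e := ψ) hfix i
  have hcp : ∀ i : ℕ, cj (ψ ^ i) a = (cj ψ a) ^ i := by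
    intro i
    induction i with
    | zero => simp
    | succ i ih => rw [pow_succ, cj_mul, hfix, ih, pow_succ]
  have hmem : cj ψ a ∈ Subgroup.zpowers ψ := by
    refine mem_zpowers_of_mem hψ (h.cj_mem hψ a) ?_
    rw [← hcp, pow_orderOf_eq_one, cj_one]
  have hall : ∀ (j : ℕ) (i : ℕ), (ψ ^ i) (j • a) = j • a := by
    intro j
    induction j with
    | zero => intro i; simpa using h.apply_zero (pow_mem hψ i)
    | succ j ih =>
      intro i
      rw [succ_nsmul', map_add_cj, hpf, hcp]
      obtain ⟨k, hk⟩ := exists_pow_of_mem hmem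
      rw [← hk, ← pow_mul, ih]
  ext x
  obtain ⟨j, hj⟩ := (isOfFinAddOrder_of_finite a).mem_multiples_iff_mem_zmultiples.mpr (ha x)
  have := hall j 1
  simp only at hj
  rw [hj, pow_one] at this
  simpa using this

/-- the kernel is nontrivial -/
lemma K_ne_bot [IsAddCyclic A] [Nontrivial A] (h : Sk φ) : h.K ≠ ⊥ := by
  intro hK
  obtain ⟨a, ha⟩ := IsAddCyclic.exists_generator (α := A)
  have ha0 : a ≠ 0 := by
    rintro rfl
    obtain ⟨x, hx⟩ := exists_ne (0 : A)
    have := ha x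
    simp at this
    exact hx this
  let D : A → Subgroup.zpowers φ := fun x => ⟨cj φ x, h.cjm x⟩
  have hD : Function.Injective D := by
    intro x y hxy
    have e : cj φ x = cj φ y := congrArg Subtype.val hxy
    have : x - y ∈ h.K := by
      rw [mem_K, sub_eq_add_neg, cj_add, e, ← cj_add, add_neg_cancel, cj_zero h.zero]
    rw [hK, AddSubgroup.mem_bot, sub_eq_zero] at this
    exact this
  let E : Subgroup.zpowers φ → A := fun ψ => (ψ : Equiv.Perm A) a
  have hE : Function.Injective E := by
    intro ψ χ hx
    have e : (ψ : Equiv.Perm A) a = (χ : Equiv.Perm A) a := hx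
    have := h.eq_one_of_fix ha (mul_mem (inv_mem χ.2) ψ.2) (by simp [e])
    ext1
    exact (inv_mul_eq_one.mp this).symm
  have hED := Finite.surjective_of_injective (hE.comp hD)
  obtain ⟨x, hx⟩ := hED 0
  have : (cj φ x) a = 0 := hx
  rw [← cj_at_zero φ x] at this
  exact ha0 ((cj φ x).injective this)

/-- the induced skew morphism on a quotient -/
lemma quot (h : Sk φ) (M : AddSubgroup A) (hMK : M ≤ h.K) (hM : ∀ x ∈ M, φ x ∈ M) :
    ∃ φ' : Equiv.Perm (A ⧸ M), Sk φ' ∧ ∀ x : A, φ' (x : A ⧸ M) = (φ x : A) := by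
  let f : A ⧸ M → A ⧸ M := Quotient.map' φ (by
    intro x y hxy
    rw [QuotientAddGroup.leftRel_apply] at hxy ⊢
    have := h.add_K' (Subgroup.mem_zpowers φ) (hMK hxy) x
    rw [add_neg_cancel_left] at this
    rw [this, neg_add_cancel_left]
    exact hM _ hxy)
  have hf : ∀ x : A, f (x : A ⧸ M) = (φ x : A) := fun x => rfl
  have hsurj : Function.Surjective f := by
    intro y
    obtain ⟨y, rfl⟩ := QuotientAddGroup.mk_surjective y
    obtain ⟨x, rfl⟩ := φ.surjective y
    exact ⟨x, hf x⟩
  let φ' : Equiv.Perm (A ⧸ M) := Equiv.ofBijective f (Finite.surjective_iff_bijective.mp hsurj)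
  have hφ' : ∀ x : A, φ' (x : A ⧸ M) = (φ x : A) := hf
  have hpow : ∀ (i : ℕ) (x : A), (φ' ^ i) (x : A ⧸ M) = ((φ ^ i) x : A) := by
    intro i
    induction i with
    | zero => intro x; simp
    | succ i ih => intro x; rw [pow_succ, Equiv.Perm.mul_apply, hφ', ih, pow_succ]; rfl
  refine ⟨φ', ⟨?_, ?_⟩, hφ'⟩
  · have := hφ' 0
    rw [h.zero] at this
    exact this
  · intro x
    obtain ⟨x, rfl⟩ := QuotientAddGroup.mk_surjective x
    obtain ⟨k, hk⟩ := exists_pow_of_mem (h.cjm x)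
    refine ⟨k, ?_⟩
    simp only [zpow_natCast]
    ext y
    obtain ⟨y, rfl⟩ := QuotientAddGroup.mk_surjective y
    rw [hpow, hk, cj_apply, cj_apply]
    rw [← QuotientAddGroup.mk_add, hφ', hφ', ← QuotientAddGroup.mk_sub]

lemma quot_pow {M : AddSubgroup A} {φ' : Equiv.Perm (A ⧸ M)}
    (hφ' : ∀ x : A, φ' (x : A ⧸ M) = (φ x : A)) (i : ℕ) (x : A) :
    (φ' ^ i) (x : A ⧸ M) = ((φ ^ i) x : A) := by
  induction i generalizing x with
  | zero => simp
  | succ i ih => rw [pow_succ, Equiv.Perm.mul_apply, hφ', ih, pow_succ]; rfl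

/-- a power of `φ` fixing a generator modulo `K` is trivial modulo `K` -/
lemma trivial_mod_K (h : Sk φ) {a : A} (ha : ∀ x, x ∈ AddSubgroup.zmultiples a) (i : ℕ)
    (hi : (φ ^ i) a - a ∈ h.K) (y : A) : (φ ^ i) y - y ∈ h.K := by
  obtain ⟨φ', h', hφ'⟩ := h.quot h.K le_rfl (fun x hx => h.map_K hx)
  have h1 : φ' ^ i = 1 := by
    refine h'.eq_one_of_fix (a := (a : A ⧸ h.K)) ?_ ⟨i, by simp⟩ ?_
    · intro x
      obtain ⟨x, rfl⟩ := QuotientAddGroup.mk_surjective x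
      obtain ⟨k, rfl⟩ := ha x
      exact ⟨k, by simp⟩
    · rw [quot_pow hφ']
      rw [← sub_eq_zero, ← QuotientAddGroup.mk_sub, QuotientAddGroup.eq_zero_iff]
      exact hi
  have h2 := quot_pow hφ' i y
  rw [h1, Equiv.Perm.one_apply, eq_comm, ← sub_eq_zero, ← QuotientAddGroup.mk_sub,
    QuotientAddGroup.eq_zero_iff] at h2
  exact h2
/-- elements of `⟨φ⟩` acting trivially modulo the kernel -/
def CH (h : Sk φ) (ψ : Equiv.Perm A) : Prop :=
  ψ ∈ Subgroup.zpowers φ ∧ ∀ y, ψ y - y ∈ h.K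

lemma CH_one (h : Sk φ) : h.CH 1 := ⟨one_mem _, fun y => by simp [zero_mem]⟩

lemma CH_mul (h : Sk φ) {ψ χ : Equiv.Perm A} (hψ : h.CH ψ) (hχ : h.CH χ) : h.CH (ψ * χ) := by
  refine ⟨mul_mem hψ.1 hχ.1, fun y => ?_⟩
  have := add_mem (hψ.2 (χ y)) (hχ.2 y)
  rw [sub_add_sub_cancel] at this
  exact this

lemma CH_pow (h : Sk φ) {ψ : Equiv.Perm A} (hψ : h.CH ψ) (i : ℕ) : h.CH (ψ ^ i) := by
  induction i with
  | zero => rw [pow_zero]; exact h.CH_one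
  | succ i ih => rw [pow_succ]; exact h.CH_mul ih hψ

lemma CH_cj (h : Sk φ) {ψ : Equiv.Perm A} (hψ : h.CH ψ) (x : A) : h.CH (cj ψ x) := by
  refine ⟨h.cj_mem hψ.1 x, fun y => ?_⟩
  have := sub_mem (hψ.2 (x + y)) (hψ.2 x)
  rw [cj_apply]
  convert this using 1
  abel

lemma cj_mul_CH (h : Sk φ) {ψ χ : Equiv.Perm A} (hψ : ψ ∈ Subgroup.zpowers φ) (hχ : h.CH χ)
    (w : A) : cj (ψ * χ) w = cj ψ w * cj χ w := by
  rw [cj_mul, h.cj_congr hψ (hχ.2 w)]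

lemma cj_pow_CH (h : Sk φ) {χ : Equiv.Perm A} (hχ : h.CH χ) (w : A) (i : ℕ) :
    cj (χ ^ i) w = (cj χ w) ^ i := by
  induction i with
  | zero => simp
  | succ i ih => rw [pow_succ, h.cj_mul_CH (pow_mem hχ.1 i) hχ, ih, pow_succ]

/-- the conjugate of an element of `CH` by a translation is a power of it -/
lemma cj_CH_mem (h : Sk φ) {χ : Equiv.Perm A} (hχ : h.CH χ) (w : A) :
    ∃ r : ℕ, χ ^ r = cj χ w := by
  refine exists_pow_of_mem (mem_zpowers_of_mem hχ.1 (h.cj_mem hχ.1 w) ?_)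
  rw [← h.cj_pow_CH hχ, pow_orderOf_eq_one, cj_one]

lemma cj_diff (h : Sk φ) {ψ : Equiv.Perm A} (hψ : h.CH ψ) (y : A) :
    cj ψ (φ y - y) = ψ := by
  have key : ∀ χ, h.CH χ → cj χ (φ y) = cj χ y := by
    intro χ hχ
    have hc : χ * φ = φ * χ := comm_of_mem hχ.1 (Subgroup.mem_zpowers φ)
    have h1 := cj_mul χ φ y
    rw [hc, cj_mul, h.cj_congr (Subgroup.mem_zpowers φ) (hχ.2 y),
      comm_of_mem (h.cjm y) (h.cj_mem hχ.1 y)] at h1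
    exact (mul_right_cancel h1).symm
  have h1 := key _ (h.CH_cj hψ (-y))
  rw [← cj_add, ← cj_add, neg_add_cancel, cj_zero (h.apply_zero hψ.1)] at h1
  rw [sub_eq_neg_add, h1]

lemma cj_diff_nsmul (h : Sk φ) {ψ : Equiv.Perm A} (hψ : h.CH ψ) (y : A) (i : ℕ) :
    cj ψ (i • (φ y - y)) = ψ := by
  induction i with
  | zero => simpa using cj_zero (h.apply_zero hψ.1)
  | succ i ih => rw [succ_nsmul, cj_add, ih, h.cj_diff hψ]

/-- `cj φ w = φ * zt φ w` -/
def _root_.SkewAux.zt (φ : Equiv.Perm A) (w : A) : Equiv.Perm A := φ⁻¹ * cj φ w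

lemma cj_eq_zt (φ : Equiv.Perm A) (w : A) : cj φ w = φ * zt φ w := by
  simp [zt]

lemma map_add_zt (φ : Equiv.Perm A) (w y : A) : φ (w + y) = φ w + φ (zt φ w y) := by
  rw [map_add_cj, cj_eq_zt]; rfl

lemma zt_mem (h : Sk φ) (w : A) : zt φ w ∈ Subgroup.zpowers φ :=
  mul_mem (inv_mem (Subgroup.mem_zpowers φ)) (h.cjm w)

lemma zt_K (h : Sk φ) (w : A) {x : A} (hx : x ∈ h.K) : zt φ w x = x := by
  simp [zt, h.cj_apply_K (Subgroup.mem_zpowers φ) hx w]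

lemma zt_eq_one (h : Sk φ) {w : A} : zt φ w = 1 ↔ w ∈ h.K := by
  rw [zt, inv_mul_eq_one, mem_K, eq_comm]

lemma zt_congr (h : Sk φ) {w w' : A} (hw : w - w' ∈ h.K) : zt φ w = zt φ w' := by
  rw [zt, zt, h.cj_congr (Subgroup.mem_zpowers φ) hw]

lemma zt_add (h : Sk φ) {w : A} (hw : h.CH (zt φ w)) (w' : A) :
    zt φ (w + w') = zt φ w' * cj (zt φ w) w' := by
  have h1 := cj_add φ w w'
  rw [cj_eq_zt φ w, h.cj_mul_CH (Subgroup.mem_zpowers φ) hw, cj_eq_zt φ w', cj_eq_zt,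
    mul_assoc] at h1
  exact mul_left_cancel h1

lemma L_add (h : Sk φ) {w : A} (hw : h.CH (zt φ w)) (y : A) :
    φ (w + y) - (φ w + φ y) ∈ h.K := by
  rw [map_add_zt, add_sub_add_left_eq_sub]
  exact h.map_sub_K (Subgroup.mem_zpowers φ) (hw.2 y)

lemma L_of_add (h : Sk φ) {w : A} (hw : ∀ y, φ (w + y) - φ w - φ y ∈ h.K) :
    h.CH (zt φ w) := by
  refine ⟨h.zt_mem w, fun y => ?_⟩
  have := hw y
  rw [map_add_zt, add_sub_cancel_left, h.map_sub_K_iff (Subgroup.mem_zpowers φ)] at this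
  exact this

/-- iterating an element of `CH` which is trivial on `K` -/
lemma CH_iter (h : Sk φ) {ψ : Equiv.Perm A} (hψ : h.CH ψ) (hK : ∀ x ∈ h.K, ψ x = x) (a : A)
    (i : ℕ) : (ψ ^ i) a = a + i • (ψ a - a) := by
  induction i with
  | zero => simp
  | succ i ih =>
    have h1 : i • (ψ a - a) ∈ h.K := nsmul_mem (hψ.2 a) i
    rw [pow_succ', Equiv.Perm.mul_apply, ih, h.add_K' hψ.1 h1, hK _ h1, succ_nsmul]
    abel

lemma zt_nsmul (h : Sk φ) (y : A) (hL : h.CH (zt φ (φ y - y))) (i : ℕ) :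
    zt φ (i • (φ y - y)) = zt φ (φ y - y) ^ i := by
  induction i with
  | zero => rw [zero_nsmul, pow_zero]; exact h.zt_eq_one.mpr (zero_mem _)
  | succ i ih =>
    have : h.CH (zt φ (i • (φ y - y))) := by rw [ih]; exact h.CH_pow hL i
    rw [succ_nsmul, h.zt_add this, ih, pow_succ']
    rw [h.cj_diff (h.CH_pow hL i)]

lemma nsmul_diff_mem_iff (h : Sk φ) {a : A} (ha : ∀ x, x ∈ AddSubgroup.zmultiples a) (y : A)
    (hL : h.CH (zt φ (φ y - y))) (i : ℕ) :
    i • (φ y - y) ∈ h.K ↔ i • (zt φ (φ y - y) a - a) = 0 := by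
  rw [← h.zt_eq_one, h.zt_nsmul y hL]
  have h1 := h.CH_iter hL (fun x hx => h.zt_K _ hx) a i
  constructor
  · intro h2
    rw [h2] at h1
    simpa using h1
  · intro h2
    rw [h2, add_zero] at h1
    exact h.eq_one_of_fix ha (pow_mem hL.1 i) h1

/-- if `φ` is not trivial modulo `K` but `φ ^ 2` is, then `φ` is additive modulo `K` -/
lemma L_all (h : Sk φ) {a : A} (ha : ∀ x, x ∈ AddSubgroup.zmultiples a)
    (h1 : φ a - a ∉ h.K) (h2 : (φ ^ 2) a - a ∈ h.K) (y : A) : h.CH (zt φ y) := by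
  have h3 : h.CH (φ ^ 2) := ⟨⟨2, by simp [zpow_ofNat]⟩, h.trivial_mod_K ha 2 h2⟩
  obtain ⟨k, hk⟩ := exists_pow_of_mem (h.cjm y)
  rcases Nat.even_or_odd' k with ⟨j, rfl | rfl⟩
  · exfalso
    rw [pow_mul] at hk
    have h4 := h.CH_pow h3 j
    rw [hk] at h4
    have h5 := h4.2 (a - y)
    have h6 := h4.2 (-y)
    rw [cj_apply] at h5 h6
    rw [add_sub_cancel] at h5
    rw [add_neg_cancel, h.zero] at h6
    have h7 := sub_mem h5 h6
    apply h1
    convert h7 using 1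
    abel
  · rw [pow_succ', cj_eq_zt] at hk
    rw [← mul_left_cancel hk, pow_mul]
    exact h.CH_pow h3 j
/-- the admissible orders -/
def _root_.SkewAux.Good (n : ℕ) : Prop := (∀ p : ℕ, p.Prime → p ≠ 2 → ¬ p * p ∣ n) ∧ ¬ 32 ∣ n

lemma good_sq {n q : ℕ} (hg : Good n) (hq : q * q ∣ n) (hn : 0 < n) :
    q = 1 ∨ q = 2 ∨ q = 4 := by
  have hq0 : q ≠ 0 := by rintro rfl; simp at hq; omega
  have h1 : ∀ {p : ℕ}, p.Prime → p ∣ q → p = 2 := by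
    intro p hp hpq
    by_contra h2
    exact hg.1 p hp h2 ((mul_dvd_mul hpq hpq).trans hq)
  have h2 := Nat.eq_prime_pow_of_unique_prime_dvd hq0 h1
  generalize q.primeFactorsList.length = j at h2
  subst h2
  by_cases hj : 3 ≤ j
  · exfalso
    apply hg.2
    refine dvd_trans ?_ hq
    rw [← pow_add]
    exact pow_dvd_pow 2 (show 5 ≤ j + j by omega)
  · interval_cases j <;> simp

/-- the case `T` : the displacement has order four and is fixed modulo `K` -/
lemma caseT (h : Sk φ) {a : A}
    (p : A →+ A ⧸ h.K) (hp : ∀ x, p x = 0 ↔ x ∈ h.K)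
    (hL : h.CH (zt φ (φ a - a)))
    (hfix : p (φ (φ a - a)) = p (φ a - a))
    (m' : ℕ) (hm' : Odd m') (e : ℕ) (hma : p (m' • a) = e • p (φ a - a))
    (h4 : ∀ s : ℕ, Odd s → s • p (φ a - a) ≠ 0) : False := by
  set τ := φ a - a with hτ
  have hφa : p (φ a) = p a + p τ := by rw [hτ, map_sub]; abel
  have hpc : ∀ ψ ∈ Subgroup.zpowers φ, ∀ x y, p x = p y → p (ψ x) = p (ψ y) := by
    intro ψ hψ x y hxy
    rw [← sub_eq_zero, ← map_sub, hp] at hxy ⊢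
    exact h.map_sub_K hψ hxy
  have hLn : ∀ i : ℕ, h.CH (zt φ (i • τ)) := by
    intro i
    rw [hτ, h.zt_nsmul a hL]
    exact h.CH_pow hL i
  have hadd : ∀ (i : ℕ) (y : A), p (φ (i • τ + y)) = p (φ (i • τ)) + p (φ y) := by
    intro i y
    rw [← map_add, ← sub_eq_zero, ← map_sub, hp]
    exact h.L_add (hLn i) y
  have hiτ : ∀ i : ℕ, p (φ (i • τ)) = i • p τ := by
    intro i
    induction i with
    | zero => simp [h.zero]
    | succ i ih => rw [succ_nsmul, hadd, ih, hfix, succ_nsmul]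
  have hT1 : ∀ (i : ℕ) (y z : A), p y = p z + i • p τ → p (φ y) = p (φ z) + i • p τ := by
    intro i y z hy
    have : p y = p (i • τ + z) := by rw [hy, map_add, map_nsmul, add_comm]
    rw [hpc φ (Subgroup.mem_zpowers φ) _ _ this, hadd, hiτ, add_comm]
  have hT2 : ∀ (y : A) (s : ℕ), p (φ y) = p y + s • p τ →
      ∀ j : ℕ, p ((φ ^ j) y) = p y + (j * s) • p τ := by
    intro y s hy j
    induction j with
    | zero => simp
    | succ j ih =>
      rw [pow_succ', Equiv.Perm.mul_apply, hT1 _ _ _ ih, hy, add_assoc, ← add_nsmul]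
      congr 2; ring
  obtain ⟨j, hj⟩ := exists_pow_of_mem (h.cjm a)
  have hrec : ∀ i : ℕ, ∃ s : ℕ, p (φ (i • a)) = p (i • a) + s • p τ ∧
      (Odd j → (Odd s ↔ Odd i)) ∧ (¬ Odd j → i ≠ 0 → Odd s) := by
    intro i
    induction i with
    | zero => exact ⟨0, by simp [h.zero]⟩
    | succ i ih =>
      obtain ⟨s, hs, h1, h2⟩ := ih
      refine ⟨1 + j * s, ?_, ?_, ?_⟩
      · rw [succ_nsmul', map_add_cj, ← hj, map_add, hφa, hT2 _ _ hs, map_add, add_nsmul, one_nsmul]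
        abel
      · intro hj
        have := h1 hj
        rw [add_comm 1, Nat.odd_add_one, Nat.odd_add_one, Nat.odd_mul, this]
        simp [hj]
      · intro hj _
        rw [Nat.odd_add]
        simp only [odd_one, true_iff]
        exact Even.mul_right (Nat.not_odd_iff_even.mp hj) _
  obtain ⟨s, hs, h1, h2⟩ := hrec m'
  have hodd : Odd s := by
    by_cases hj : Odd j
    · exact (h1 hj).mpr hm'
    · exact h2 hj (by rintro rfl; simp at hm')
  have hfm : p (φ (m' • a)) = p (m' • a) := by
    rw [hma, ← hiτ]
    exact hpc φ (Subgroup.mem_zpowers φ) _ _ (by rw [hma, map_nsmul])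
  rw [hfm] at hs
  exact h4 s hodd (by simpa using hs)

/-- the final computation -/
lemma final [IsAddCyclic A] (h : Sk φ) (b : A) (hχ : h.CH (zt φ b)) (hcj : cj (zt φ b) b = zt φ b)
    (hb : φ b + b ∈ h.K) (h4b : 4 • b ∈ h.K) (h4K : ∀ x ∈ h.K, 4 • x = 0)
    (hk : 2 • (zt φ b b - b) ≠ 0) : False := by
  set χ := zt φ b with hχd
  set κ := χ b - b with hκ
  have hκK : κ ∈ h.K := hχ.2 b
  have hφm := Subgroup.mem_zpowers φ
  have hχb : χ b = b + κ := by rw [hκ]; abel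
  have hstep : ∀ y, φ (b + y) = φ b + φ (χ y) := fun y => map_add_zt φ b y
  have hχstep : ∀ y, χ (b + y) = b + κ + χ y := by
    intro y
    rw [map_add_cj, hcj, hχb]
  have hχK : ∀ x ∈ h.K, χ x = x := fun x hx => h.zt_K b hx
  have hχneg : χ (-b) = - b - κ := by
    have := hχstep (-b)
    rw [add_neg_cancel, h.apply_zero hχ.1] at this
    rw [eq_comm, add_eq_zero_iff_neg_eq] at this
    rw [← this]; abel
  have hφκ : φ κ = - κ := by
    have hc := congrArg (fun g : Equiv.Perm A => g b) (comm_of_mem hφm hχ.1)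
    simp only [Equiv.Perm.mul_apply] at hc
    have e : φ b = (φ b + b) + (-b) := by abel
    rw [hχb, h.add_K' hφm hκK, e, h.add_K hχ.1 hb, hχK _ hb, hχneg] at hc
    have := congrArg (fun z => z - (φ b + b - b)) hc
    convert this using 1 <;> abel
  have hφn : ∀ i : ℕ, φ (i • κ) = - (i • κ) := by
    intro i
    rw [h.nsmul_K hφm hκK, hφκ, smul_neg]
  have h4κ : 4 • κ = 0 := h4K κ hκK
  -- compute
  have c2 : χ (b + b) = b + b + 2 • κ := by rw [hχstep, hχb]; abel
  have c3 : χ (b + (b + b)) = b + (b + b) + 3 • κ := by rw [hχstep, c2]; abel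
  have f2 : φ (b + b) = 2 • φ b - κ := by
    rw [hstep, hχb, h.add_K' hφm hκK, hφκ]; abel
  have f3 : φ (b + (b + b)) = 3 • φ b - 3 • κ := by
    rw [hstep, c2, h.add_K' hφm (nsmul_mem hκK 2), hφn, f2]; abel
  have f4 : φ (4 • b) = 4 • φ b - 6 • κ := by
    have : 4 • b = b + (b + (b + b)) := by abel
    rw [this, hstep, c3, h.add_K' hφm (nsmul_mem hκK 3), hφn, f3]; abel
  have hord : addOrderOf κ = 4 := by
    have h1 : addOrderOf κ ∣ 2 ^ 2 := addOrderOf_dvd_of_nsmul_eq_zero h4κ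
    have h2 : ¬ addOrderOf κ ∣ 2 ^ 1 := by
      rw [addOrderOf_dvd_iff_nsmul_eq_zero]; exact hk
    have := addOrderOf_eq_prime_pow (x := κ) (p := 2) (n := 1) (by simpa using hk)
      (by simpa using h4κ)
    simpa using this
  have hmem := mem_zmultiples_of_nsmul_eq_zero κ (4 • b) (by rw [hord]; exact h4K _ h4b)
  obtain ⟨i, hi⟩ := (isOfFinAddOrder_of_finite κ).mem_multiples_iff_mem_zmultiples.mpr hmem
  simp only at hi
  have f4' : φ (4 • b) = - (4 • b) := by rw [← hi, hφn]
  have h5 : 4 • (φ b + b) = 0 := h4K _ hb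
  apply hk
  have e : 2 • κ = 2 • (4 • κ) - 6 • κ := by abel
  have e2 : - (6 • κ) = φ (4 • b) - 4 • φ b := by rw [f4]; abel
  rw [e, h4κ, nsmul_zero, zero_sub, e2, f4']
  have e3 : (-((4 : ℕ) • b) - (4 : ℕ) • φ b : A) = - ((4 : ℕ) • (φ b + b)) := by abel
  rw [e3, h5, neg_zero]

lemma map_add_of_all (h : Sk φ) (hall : ∀ y, h.CH (zt φ y)) (p : A →+ A ⧸ h.K)
    (hp : ∀ x, p x = 0 ↔ x ∈ h.K) (x y : A) : p (φ (x + y)) = p (φ x) + p (φ y) := by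
  rw [← map_add, ← sub_eq_zero, ← map_sub, hp]
  exact h.L_add (hall x) y

lemma map_nsmul_of_all (h : Sk φ) (hall : ∀ y, h.CH (zt φ y)) (p : A →+ A ⧸ h.K)
    (hp : ∀ x, p x = 0 ↔ x ∈ h.K) (x : A) (i : ℕ) : p (φ (i • x)) = i • p (φ x) := by
  induction i with
  | zero => simp [h.zero]
  | succ i ih => rw [succ_nsmul, h.map_add_of_all hall p hp, ih, succ_nsmul]

/-- the case `S` when the displacement has order two modulo `K` -/
lemma caseS2 [IsAddCyclic A] (h : Sk φ) {a : A} (ha : ∀ x, x ∈ AddSubgroup.zmultiples a)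
    (hall : ∀ y, h.CH (zt φ y)) (p : A →+ A ⧸ h.K) (hp : ∀ x, p x = 0 ↔ x ∈ h.K)
    (h1 : φ a - a ∉ h.K) (b : A) (m' : ℕ) (hb : b = m' • a)
    (hτ : φ a - a - (b + b) ∈ h.K) (h4b : 4 • b ∈ h.K) (h4K : ∀ x ∈ h.K, 4 • x = 0)
    (hodd : (∃ x ∈ h.K, 2 • x ≠ 0) → Odd m') : False := by
  have hχ := hall b
  have hzd : zt φ (φ a - a) = zt φ b * cj (zt φ b) b := by
    rw [h.zt_congr hτ, h.zt_add hχ]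
  have hz1 : zt φ (φ a - a) ≠ 1 := fun hc => h1 (h.zt_eq_one.mp hc)
  have hzCH := hall (φ a - a)
  have hχK : ∀ x ∈ h.K, zt φ b x = x := fun x hx => h.zt_K b hx
  have hzK : ∀ x ∈ h.K, zt φ (φ a - a) x = x := fun x hx => h.zt_K _ hx
  generalize hz : zt φ (φ a - a) = z at *
  generalize hχe : zt φ b = χ at *
  have hχ4 : χ ^ 4 = 1 := by
    refine h.eq_one_of_fix ha (pow_mem hχ.1 4) ?_
    rw [h.CH_iter hχ hχK, h4K _ (hχ.2 a), add_zero]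
  have hone : cj χ b ≠ 1 := by
    intro hc
    have : χ = 1 := eq_one_of_cj (h.apply_zero hχ.1) hc
    rw [hc, this] at hzd
    exact hz1 (by simpa using hzd)
  have hcj : cj χ b = χ := by
    obtain ⟨r, hr⟩ := h.cj_CH_mem hχ b
    rw [pow_eq_pow_mod r hχ4] at hr
    have hr4 : r % 4 < 4 := Nat.mod_lt _ (by norm_num)
    interval_cases hq : r % 4
    · exact absurd (by rw [← hr, pow_zero]) hone
    · rw [← hr, pow_one]
    · exfalso
      have h2 : cj (χ ^ 2) b = 1 := by
        rw [h.cj_pow_CH hχ, ← hr, ← pow_mul]; exact hχ4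
      have h3 : χ ^ 2 = 1 := eq_one_of_cj (h.apply_zero (pow_mem hχ.1 2)) h2
      exact hone (by rw [← hr, h3])
    · exfalso
      apply hz1
      rw [hzd, ← hr, ← pow_succ']
      exact hχ4
  have hzχ : z = χ ^ 2 := by rw [hzd, hcj, sq]
  have hm : Odd m' := by
    refine hodd ⟨χ a - a, hχ.2 a, fun hc => hz1 ?_⟩
    rw [hzχ]
    refine h.eq_one_of_fix ha (pow_mem hχ.1 2) ?_
    rw [h.CH_iter hχ hχK, hc, add_zero]
  have hz2 : z ^ 2 = 1 := by rw [hzχ, ← pow_mul]; exact hχ4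
  have hcz : cj z a = z := by
    obtain ⟨r, hr⟩ := h.cj_CH_mem hzCH a
    rw [pow_eq_pow_mod r hz2] at hr
    have hr4 : r % 2 < 2 := Nat.mod_lt _ (by norm_num)
    interval_cases hq : r % 2
    · exact absurd (eq_one_of_cj (h.apply_zero hzCH.1) (by rw [← hr, pow_zero])) hz1
    · rw [← hr, pow_one]
  have hzi : ∀ i : ℕ, z (i • a) = i • z a := by
    intro i
    induction i with
    | zero => simpa using h.apply_zero hzCH.1
    | succ i ih => rw [succ_nsmul', map_add_cj, hcz, ih, succ_nsmul']
  have hk : 2 • (χ b - b) ≠ 0 := by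
    intro hc
    have e1 : z b = b := by
      rw [hzχ, h.CH_iter hχ hχK, hc, add_zero]
    have e2 : m' • (z a - a) = 0 := by
      rw [smul_sub, ← hzi, ← hb, e1, sub_self]
    have e3 : 2 • (z a - a) = 0 := by
      have := h.CH_iter hzCH hzK a 2
      rw [hz2] at this
      simpa using this
    obtain ⟨k, hk⟩ := hm
    have e4 : z a - a = 0 := by
      rw [hk, add_nsmul, one_nsmul, mul_comm, mul_nsmul', e3, smul_zero, zero_add] at e2
      exact e2
    exact hz1 (h.eq_one_of_fix ha hzCH.1 (sub_eq_zero.mp e4))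
  have hpτ : p (φ a - a) = 2 • p b := by
    rw [two_nsmul, ← map_add, ← sub_eq_zero, ← map_sub, hp]; exact hτ
  have hp4 : 4 • p b = 0 := by rw [← map_nsmul, hp]; exact h4b
  have hφb : φ b + b ∈ h.K := by
    rw [← hp, map_add]
    have e1 : p (φ b) = p b + m' • p (φ a - a) := by
      rw [hb, h.map_nsmul_of_all hall p hp, map_sub, smul_sub, map_nsmul]; abel
    obtain ⟨k, hk⟩ := hm
    have e2 : p b + m' • p (φ a - a) + p b = (k + 1) • 4 • p b := by
      rw [hpτ, hk]
      simp only [← mul_nsmul]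
      have : 2 * (2 * k + 1) = k * 4 + 2 := by ring
      rw [this, add_nsmul]
      have : 4 * (k + 1) = k * 4 + 4 := by ring
      rw [this, add_nsmul]
      abel
    rw [e1, e2, hp4, smul_zero]
  subst hχe
  exact h.final b hχ hcj hφb h4b h4K hk

/-- the case `S` -/
lemma caseS [IsAddCyclic A] (h : Sk φ) {a : A} (ha : ∀ x, x ∈ AddSubgroup.zmultiples a)
    (hall : ∀ y, h.CH (zt φ y)) (p : A →+ A ⧸ h.K) (hp : ∀ x, p x = 0 ↔ x ∈ h.K)
    (h1 : φ a - a ∉ h.K) (m g q : ℕ) (hm : ∀ i : ℕ, i • a ∈ h.K ↔ m ∣ i)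
    (hq : q = 2 ∨ q = 4) (hqm : q ∣ m) (hqg : q ∣ 2 ^ g)
    (hqτ : ∀ i : ℕ, i • (φ a - a) ∈ h.K ↔ q ∣ i)
    (hev : ∀ i : ℕ, Even i → p (φ (φ a - a)) ≠ i • p (φ a - a))
    (hgK : ∀ x ∈ h.K, 2 ^ g • x = 0) (h32 : ¬ 32 ∣ m * 2 ^ g) : False := by
  obtain ⟨t, ht⟩ := (isOfFinAddOrder_of_finite a).mem_multiples_iff_mem_zmultiples.mpr
    (ha (φ a - a))
  simp only at ht
  have hmt : ∀ i : ℕ, m ∣ i * t ↔ q ∣ i := by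
    intro i
    rw [← hqτ, ← hm, ← ht, mul_comm, mul_nsmul]
  have htev : Even t := by
    by_contra hto
    refine hev (1 + t) ?_ ?_
    · rw [Nat.not_even_iff_odd] at hto
      exact odd_one.add_odd hto
    · have : p (φ (t • a)) = t • p a + t • p (φ a - a) := by
        rw [h.map_nsmul_of_all hall p hp, ← smul_add]
        congr 1
        rw [map_sub]; abel
      rw [ht, ← map_nsmul, ht] at this
      rw [this, add_nsmul, one_nsmul]
  obtain ⟨t', rfl⟩ := htev.two_dvd
  rcases hq with rfl | rfl
  · obtain ⟨h0, rfl⟩ := hqm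
    have e1 : h0 ∣ 2 * t' := by
      have := (hmt 2).mpr dvd_rfl
      exact (Nat.mul_dvd_mul_iff_left (by norm_num)).mp this
    obtain ⟨u, hu⟩ := e1
    have huo : Odd u := by
      by_contra hc
      rw [Nat.not_odd_iff_even] at hc
      obtain ⟨v, rfl⟩ := hc.two_dvd
      have := (hmt 1).mp (by rw [one_mul, hu]; exact ⟨v, by ring⟩)
      norm_num at this
    have hhe : Even h0 := by
      have : Even (h0 * u) := by rw [← hu]; exact even_two_mul _
      rcases Nat.even_mul.mp this with h | h
      · exact h
      · exact absurd h (Nat.not_even_iff_odd.mpr huo)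
    obtain ⟨m', rfl⟩ := hhe.two_dvd
    obtain ⟨v, rfl⟩ := huo
    have hg2 : g ≤ 2 := by
      by_contra hc
      apply h32
      have : (2 : ℕ) ^ 3 ∣ 2 ^ g := pow_dvd_pow 2 (by omega)
      obtain ⟨w, hw⟩ := this
      exact ⟨m' * w, by rw [hw]; ring⟩
    refine h.caseS2 ha hall p hp h1 (m' • a) m' rfl ?_ ?_ ?_ ?_
    · rw [← ht, hu]
      have : (2 * m' * (2 * v + 1)) • a - (m' • a + m' • a) = (2 * (2 * m') * v) • a := by
        have : 2 * m' * (2 * v + 1) = 2 * (2 * m') * v + (m' + m') := by ring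
        rw [this, add_nsmul, add_nsmul]; abel
      rw [this, hm]
      exact dvd_mul_right _ _
    · rw [← mul_nsmul, hm]; exact ⟨1, by ring⟩
    · intro x hx
      have : 4 = 2 ^ g * 2 ^ (2 - g) := by rw [← pow_add, Nat.add_sub_cancel' hg2]; norm_num
      rw [this, mul_nsmul, hgK x hx, smul_zero]
    · rintro ⟨x, hx, hx2⟩
      by_contra hc
      rw [Nat.not_odd_iff_even] at hc
      obtain ⟨w, rfl⟩ := hc.two_dvd
      have hg1 : g = 2 := by
        by_contra hne
        apply hx2
        have : 2 = 2 ^ g * 2 ^ (1 - g) := by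
          rw [← pow_add, Nat.add_sub_cancel' (by omega)]; norm_num
        rw [this, mul_nsmul, hgK x hx, smul_zero]
      apply h32
      rw [hg1]
      exact ⟨w, by ring⟩
  · obtain ⟨m', rfl⟩ := hqm
    have hmo : Odd m' := by
      by_contra hc
      rw [Nat.not_odd_iff_even] at hc
      obtain ⟨w, rfl⟩ := hc.two_dvd
      obtain ⟨v, hv⟩ := hqg
      apply h32
      rw [hv]
      exact ⟨w * v, by ring⟩
    have e1 : m' ∣ 2 * t' := by
      have := (hmt 4).mpr dvd_rfl
      exact (Nat.mul_dvd_mul_iff_left (by norm_num)).mp this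
    have e2 : m' ∣ t' := by
      refine Nat.Coprime.dvd_of_dvd_mul_left ?_ e1
      exact (Nat.coprime_two_right).mpr hmo
    obtain ⟨v, rfl⟩ := e2
    have := (hmt 2).mp ⟨v, by ring⟩
    norm_num at this

/-- the main step of the induction -/
lemma step [IsAddCyclic A] (h : Sk φ) (hg : Good (Nat.card A))
    (hM : ∀ M : AddSubgroup A, M ≤ h.K → M ≠ ⊥ → (∀ x ∈ M, φ x ∈ M) →
      ∀ x y, φ ((φ x - x) + y) - φ (φ x - x) - φ y ∈ M) (x : A) : φ x - x ∈ h.K := by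
  obtain ⟨a, ha⟩ := IsAddCyclic.exists_generator (α := A)
  by_cases h1 : φ a - a ∈ h.K
  · have := h.trivial_mod_K ha 1 (by simpa using h1) x
    simpa using this
  exfalso
  have hφm := Subgroup.mem_zpowers φ
  have : Nontrivial A := ⟨φ a - a, 0, fun hc => h1 (by rw [hc]; exact zero_mem _)⟩
  have hKb := h.K_ne_bot
  have hL : h.CH (zt φ (φ a - a)) :=
    h.L_of_add (hM h.K le_rfl hKb (fun x hx => h.map_K hx) a)
  obtain ⟨κ, hκ⟩ : ∃ κ, κ = zt φ (φ a - a) a - a := ⟨_, rfl⟩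
  have hκK : κ ∈ h.K := by rw [hκ]; exact hL.2 a
  obtain ⟨q, hq⟩ : ∃ q, q = addOrderOf κ := ⟨_, rfl⟩
  obtain ⟨p, hpd⟩ : ∃ p : A →+ A ⧸ h.K, p = QuotientAddGroup.mk' h.K := ⟨_, rfl⟩
  have hp : ∀ x, p x = 0 ↔ x ∈ h.K := by
    intro x; rw [hpd]; exact QuotientAddGroup.eq_zero_iff x
  have hps : Function.Surjective p := by
    rw [hpd]; exact QuotientAddGroup.mk'_surjective _
  have hqτ : ∀ i : ℕ, i • (φ a - a) ∈ h.K ↔ q ∣ i := by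
    intro i
    rw [h.nsmul_diff_mem_iff ha a hL, ← hκ, hq, addOrderOf_dvd_iff_nsmul_eq_zero]
  obtain ⟨m, hmd⟩ : ∃ m, m = Nat.card (A ⧸ h.K) := ⟨_, rfl⟩
  have hcard : Nat.card A = m * Nat.card h.K := by
    rw [hmd]; exact AddSubgroup.card_eq_card_quotient_mul_card_addSubgroup _
  have hpa : ∀ x, x ∈ AddSubgroup.zmultiples (p a) := by
    intro x
    obtain ⟨x, rfl⟩ := hps x
    obtain ⟨i, rfl⟩ := ha x
    exact ⟨i, by simp⟩
  have hm : ∀ i : ℕ, i • a ∈ h.K ↔ m ∣ i := by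
    intro i
    rw [← hp, map_nsmul, ← addOrderOf_dvd_iff_nsmul_eq_zero, addOrderOf_eq_card_of_forall_mem_zmultiples hpa, hmd]
  have hcycQ : IsAddCyclic (A ⧸ h.K) := ⟨p a, hpa⟩
  have hpq : addOrderOf (p (φ a - a)) = q := by
    apply Nat.dvd_antisymm
    · rw [addOrderOf_dvd_iff_nsmul_eq_zero, ← map_nsmul, hp, hqτ]
    · rw [← hqτ, ← hp, map_nsmul, addOrderOf_nsmul_eq_zero]
  have hqm : q ∣ m := by rw [← hpq, hmd]; exact addOrderOf_dvd_natCard _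
  have hKx : ∀ x ∈ h.K, Nat.card h.K • x = 0 := by
    intro x hx
    have := card_nsmul_eq_zero' (x := (⟨x, hx⟩ : h.K))
    exact congrArg Subtype.val this
  have hqK : q ∣ Nat.card h.K := by
    rw [hq, addOrderOf_dvd_iff_nsmul_eq_zero]; exact hKx κ hκK
  have hq24 : q = 2 ∨ q = 4 := by
    rcases good_sq hg (hcard ▸ mul_dvd_mul hqm hqK) Nat.card_pos with h' | h' | h'
    · exfalso
      apply h1
      have := (hqτ 1).mpr (by rw [h'])
      simpa using this
    · exact Or.inl h'
    · exact Or.inr h'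
  have hφκ : ∀ M : AddSubgroup A, M ≤ h.K → M ≠ ⊥ → (∀ x ∈ M, φ x ∈ M) → φ κ ∈ M := by
    intro M h1 h2 h3
    have := hM M h1 h2 h3 a a
    have e : zt φ (φ a - a) a = a + κ := by rw [hκ]; abel
    rw [map_add_zt, e, h.add_K' hφm hκK] at this
    convert this using 1
    abel
  have hK2 : ∀ {r : ℕ}, r.Prime → r ∣ Nat.card h.K → r = 2 := by
    intro r hr hrK
    by_contra hr2
    have := Fact.mk hr
    obtain ⟨u, hu⟩ := exists_prime_addOrderOf_dvd_card' r hrK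
    have hru : addOrderOf (u : A) = r := by rw [AddSubgroup.addOrderOf_coe, hu]
    have hru0 : r • (u : A) = 0 := by rw [← hru]; exact addOrderOf_nsmul_eq_zero _
    have hφu : φ u ∈ AddSubgroup.zmultiples (u : A) := by
      apply mem_zmultiples_of_nsmul_eq_zero
      rw [hru, ← h.nsmul_K hφm u.2, hru0, h.zero]
    have hmem := hφκ (AddSubgroup.zmultiples (u : A))
      (by rw [AddSubgroup.zmultiples_le]; exact u.2)
      (by
        intro hc
        rw [AddSubgroup.zmultiples_eq_bot] at hc
        rw [hc, addOrderOf_zero] at hru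
        exact hr.one_lt.ne hru)
      (by
        intro y hy
        obtain ⟨i, rfl⟩ := (isOfFinAddOrder_of_finite (u : A)).mem_multiples_iff_mem_zmultiples.mpr hy
        simp only
        rw [h.nsmul_K hφm u.2]
        exact nsmul_mem hφu i)
    have hr0 : r • κ = 0 := by
      apply φ.injective
      rw [h.nsmul_K hφm hκK, h.zero]
      obtain ⟨i, hi⟩ := (isOfFinAddOrder_of_finite (u : A)).mem_multiples_iff_mem_zmultiples.mpr hmem
      simp only at hi
      rw [← hi, ← mul_nsmul, mul_comm, mul_nsmul, hru0, smul_zero]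
    have : q ∣ r := by rw [hq]; exact addOrderOf_dvd_of_nsmul_eq_zero hr0
    have h2r : 2 ∣ r := by
      rcases hq24 with h' | h'
      · rw [h'] at this; exact this
      · rw [h'] at this; exact (by norm_num : 2 ∣ 4).trans this
    exact hr2 ((Nat.prime_dvd_prime_iff_eq Nat.prime_two hr).mp h2r).symm
  obtain ⟨g, hgK⟩ : ∃ g, Nat.card h.K = 2 ^ g :=
    ⟨_, Nat.eq_prime_pow_of_unique_prime_dvd Nat.card_pos.ne' hK2⟩
  rw [hgK] at hcard hqK hKx
  have h32 : ¬ 32 ∣ m * 2 ^ g := by rw [← hcard]; exact hg.2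
  -- the displacement of the displacement
  have hφadd : ∀ i : ℕ, p (φ (i • (φ a - a))) = i • p (φ (φ a - a)) := by
    intro i
    induction i with
    | zero => simp [h.zero]
    | succ i ih =>
      have := h.L_add hL (i • (φ a - a))
      rw [← hp, map_sub p, map_add p, sub_eq_zero] at this
      rw [succ_nsmul', this, ih, succ_nsmul']
  have hqφ : q • p (φ (φ a - a)) = 0 := by
    rw [← hφadd, hp, h.map_K_iff hφm, hqτ]
  obtain ⟨i, hi⟩ : ∃ i : ℕ, i • p (φ a - a) = p (φ (φ a - a)) := by
    have := mem_zmultiples_of_nsmul_eq_zero (p (φ a - a)) (p (φ (φ a - a))) (by rw [hpq, hqφ])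
    obtain ⟨i, hi⟩ := (isOfFinAddOrder_of_finite _).mem_multiples_iff_mem_zmultiples.mpr this
    exact ⟨i, hi⟩
  have hpn : ∀ i : ℕ, i • p (φ a - a) = 0 ↔ q ∣ i := by
    intro i; rw [← map_nsmul, hp, hqτ]
  have hev : ∀ i : ℕ, Even i → p (φ (φ a - a)) ≠ i • p (φ a - a) := by
    intro i hie hi
    obtain ⟨j, rfl⟩ := hie.two_dvd
    rcases hq24 with h' | h'
    · rw [(hpn _).mpr (by rw [h']; exact dvd_mul_right _ _), hp, h.map_K_iff hφm] at hi
      exact h1 hi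
    · have e : p (φ (2 • (φ a - a))) = 0 := by
        rw [hφadd, hi, ← mul_nsmul, hpn, h']
        exact ⟨j, by ring⟩
      rw [hp, h.map_K_iff hφm, hqτ, h'] at e
      norm_num at e
  by_cases hS : (φ ^ 2) a - a ∈ h.K
  · exact h.caseS ha (h.L_all ha h1 hS) p hp h1 m g q hm hq24 hqm hqK hqτ hev hKx h32
  have hi1 : ¬ q ∣ i + 1 := by
    intro hc
    apply hS
    rw [← hp]
    have e : (φ ^ 2) a = φ ((φ a - a) + a) := by simp [sq]
    have := h.L_add hL a
    rw [← hp, map_sub p, map_add p, sub_eq_zero] at this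
    rw [map_sub, e, this, ← hi]
    have : p (φ a) = p (φ a - a) + p a := by rw [← map_add, sub_add_cancel]
    rw [this]
    have e2 := (hpn (i + 1)).mpr hc
    rw [add_nsmul, one_nsmul] at e2
    rw [← add_assoc, add_sub_cancel_right, e2]
  have hiodd : Odd i := by
    by_contra hc
    rw [Nat.not_odd_iff_even] at hc
    exact hev i hc hi.symm
  have hq4 : q = 4 := by
    rcases hq24 with h' | h'
    · exfalso
      apply hi1
      rw [h']
      exact (hiodd.add_odd odd_one).two_dvd
    · exact h'
  subst hq4
  have hfix : p (φ (φ a - a)) = p (φ a - a) := by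
    obtain ⟨j, rfl⟩ : ∃ j, i = 4 * j + 1 := by
      obtain ⟨k, rfl⟩ := hiodd
      exact ⟨k / 2, by omega⟩
    rw [← hi, add_nsmul, one_nsmul, (hpn _).mpr (dvd_mul_right _ _), zero_add]
  obtain ⟨m', hm'⟩ := hqm
  have hmo : Odd m' := by
    by_contra hc
    rw [Nat.not_odd_iff_even] at hc
    obtain ⟨w, rfl⟩ := hc.two_dvd
    obtain ⟨v, hv⟩ := hqK
    apply h32
    rw [hv, hm']
    exact ⟨w * v, by ring⟩
  obtain ⟨e, he⟩ : ∃ e : ℕ, e • p (φ a - a) = p (m' • a) := by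
    have := mem_zmultiples_of_nsmul_eq_zero (p (φ a - a)) (p (m' • a)) (by
      rw [hpq, ← map_nsmul, hp, ← mul_nsmul, hm, hm', mul_comm])
    obtain ⟨i, hi⟩ := (isOfFinAddOrder_of_finite _).mem_multiples_iff_mem_zmultiples.mpr this
    exact ⟨i, hi⟩
  refine h.caseT p hp hL hfix m' hmo e he.symm ?_
  intro s hs hc
  rw [hpn] at hc
  have : 2 ∣ s := (by norm_num : 2 ∣ 4).trans hc
  exact (Nat.not_even_iff_odd.mpr hs) (even_iff_two_dvd.mpr this)

lemma good_of_dvd {n k : ℕ} (hg : Good n) (hk : k ∣ n) : Good k :=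
  ⟨fun p hp h2 hd => hg.1 p hp h2 (hd.trans hk), fun hd => hg.2 (hd.trans hk)⟩

end Sk
end

/-- every skew morphism of a cyclic group of admissible order is smooth -/
theorem diff_mem_K (N : ℕ) : ∀ (A : Type) [AddCommGroup A] [Finite A] [IsAddCyclic A]
    (φ : Equiv.Perm A) (h : Sk φ), Nat.card A = N → Good N → ∀ x, φ x - x ∈ h.K := by
  induction N using Nat.strong_induction_on with
  | _ N ih =>
  intro A _ _ _ φ h hN hg x
  refine h.step (hN ▸ hg) ?_ x
  intro M hMK hMb hMφ x y
  obtain ⟨φ', h', hφ'⟩ := h.quot M hMK hMφ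
  have hc := AddSubgroup.card_eq_card_quotient_mul_card_addSubgroup M
  have hM1 : 1 < Nat.card M := by
    rw [AddSubgroup.one_lt_card_iff_ne_bot]; exact hMb
  have hpos : 0 < Nat.card (A ⧸ M) := Nat.card_pos
  have hlt : Nat.card (A ⧸ M) < N := by
    rw [← hN, hc]
    nlinarith
  have hcyc : IsAddCyclic (A ⧸ M) :=
    isAddCyclic_of_surjective (QuotientAddGroup.mk' M) (QuotientAddGroup.mk'_surjective M)
  have := ih _ hlt (A ⧸ M) φ' h' rfl (Sk.good_of_dvd hg (hN ▸ Dvd.intro _ hc.symm)) (x : A ⧸ M)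
  rw [Sk.mem_K] at this
  have h2 := congrArg (fun f : Equiv.Perm (A ⧸ M) => f (y : A ⧸ M)) this
  simp only [cj_apply] at h2
  rw [hφ', ← QuotientAddGroup.mk_sub, ← QuotientAddGroup.mk_add, hφ', hφ', hφ',
    ← QuotientAddGroup.mk_sub, ← sub_eq_zero, ← QuotientAddGroup.mk_sub,
    QuotientAddGroup.eq_zero_iff] at h2
  exact h2

end SkewAux

theorem stmt10 (n : ℕ) (hn : 0 < n) :
    (∀ (φ : Equiv.Perm (ZMod n)) (π : ZMod n → ℤ),
      IsAddSkewMorphism φ π → IsAddSmooth φ π) ↔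
    ∃ e n₁ : ℕ, n = 2 ^ e * n₁ ∧ e ≤ 4 ∧ Odd n₁ ∧ Squarefree n₁ := by
  constructor
  · intro H
    have h1 : ∀ p : ℕ, p.Prime → p ≠ 2 → ¬ p * p ∣ n := by
      intro p hp h2 hd
      obtain ⟨φ, π, hs, hns⟩ := SkewAux.nonsmooth_odd n p hn hp h2 hd
      exact hns (H φ π hs)
    have h2 : ¬ 32 ∣ n := by
      intro hd
      obtain ⟨φ, π, hs, hns⟩ := SkewAux.nonsmooth_two n hn hd
      exact hns (H φ π hs)
    obtain ⟨e, n₁, hodd, rfl⟩ := Nat.exists_eq_two_pow_mul_odd hn.ne'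
    refine ⟨e, n₁, rfl, ?_, hodd, ?_⟩
    · by_contra hc
      apply h2
      exact Dvd.dvd.mul_right (pow_dvd_pow 2 (show 5 ≤ e by omega)) n₁
    · rw [Nat.squarefree_iff_prime_squarefree]
      intro p hp hd
      refine h1 p hp ?_ (hd.mul_left _)
      rintro rfl
      have : 2 ∣ n₁ := (dvd_mul_right 2 2).trans hd
      exact (Nat.not_even_iff_odd.mpr hodd) (even_iff_two_dvd.mpr this)
  · rintro ⟨e, n₁, hne, he, hodd, hsq⟩ φ π ⟨h0, hadd⟩ x
    have : NeZero n := ⟨hn.ne'⟩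
    have hg : SkewAux.Good n := by
      have hcop : Nat.Coprime 2 n₁ := Nat.coprime_two_left.mpr hodd
      constructor
      · intro p hp hp2 hd
        rw [hne] at hd
        have hc : Nat.Coprime (p * p) (2 ^ e) := by
          have : Nat.Coprime p 2 := (Nat.coprime_primes hp Nat.prime_two).mpr hp2
          exact (this.mul_left this).pow_right e
        exact (Nat.squarefree_iff_prime_squarefree.mp hsq) p hp (hc.dvd_of_dvd_mul_left hd)
      · intro hd
        rw [hne] at hd
        have hc : Nat.Coprime (2 ^ 5) n₁ := hcop.pow_left 5
        have := hc.dvd_of_dvd_mul_right hd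
        have := Nat.pow_dvd_pow_iff_le_right' (b := 0) |>.mp this
        omega
    have hcj : ∀ x, SkewAux.cj φ x = φ ^ π x := by
      intro x
      ext y
      rw [SkewAux.cj_apply, hadd, add_sub_cancel_left]
    have h : SkewAux.Sk φ := ⟨h0, fun x => ⟨π x, (hcj x).symm⟩⟩
    have hk := SkewAux.diff_mem_K n (ZMod n) φ h (Nat.card_zmod n) hg x
    have := h.cj_congr (Subgroup.mem_zpowers φ) hk
    rw [hcj, hcj] at this
    exact zpow_eq_zpow_iff_modEq.mp this
end
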